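/- Let X ⊆ ℝⁿ be a finite set with |X| ≥ 2, n ≥ 1, p ∈ [1,∞], q ≥ 1, and c(x,y) := ‖x − y‖_p^q. Set m := n^{max{1/p, 1 − 1/p}} and γ := max{ ‖x − y‖_p : x, y ∈ X } / min{ ‖x − y‖_p : x, y ∈ X, x ≠ y }. Then r*_c(P(X)) < 28.66 · m · γ^{q−1} · log( γ/m + 1 ). -/

import Mathlib

open MeasureTheory ENNReal

noncomputable section

/-- The optimal transport cost `C*_c(P,Q)` between two Borel measures for the cost `c`:
the infimum of `∫ c dγ` over couplings `γ` of `(P, Q)`. -/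
def Cstar {X : Type*} [MeasurableSpace X] (c : X → X → ℝ) (P Q : Measure X) : ℝ≥0∞ :=
  ⨅ γ ∈ {γ : Measure (X × X) |
      IsProbabilityMeasure γ ∧ γ.map Prod.fst = P ∧ γ.map Prod.snd = Q},
    ∫⁻ z, ENNReal.ofReal (c z.1 z.2) ∂γ

/-- The standard probability space: `[0,1]` with Lebesgue measure. -/
def stdSpace : Measure ℝ := volume.restrict (Set.Icc (0 : ℝ) 1)

/-- `f` is a coupling of the family of probability measures `P` on the standard
probability space `([0,1], Lebesgue)`: each `f a` is measurable with law `P a`. -/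
structure IsCoupling {X A : Type*} [MeasurableSpace X]
    (P : A → Measure X) (f : A → ℝ → X) : Prop where
  measurable : ∀ a, Measurable (f a)
  law : ∀ a, stdSpace.map (f a) = P a

/-- The pairwise coupling ratio `r_c({X_α})` of a coupling `f` of the family `P`:
the least `r ≥ 1` such that `E[c(X_a, X_b)] ≤ r ⬝ C*_c(P_a, P_b)` for all `a, b`
(`∞` if no such `r` exists). -/
def couplingRatio {X A : Type*} [MeasurableSpace X]
    (c : X → X → ℝ) (P : A → Measure X) (f : A → ℝ → X) : ℝ≥0∞ :=
  sInf {r : ℝ≥0∞ | 1 ≤ r ∧ ∀ a b : A,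
    ∫⁻ u, ENNReal.ofReal (c (f a u) (f b u)) ∂stdSpace ≤ r * Cstar c (P a) (P b)}

/-- The optimal pairwise coupling ratio `r*_c({P_α})` of a family of probability
measures: the infimum of `r_c({X_α})` over all couplings of the family. -/
def optRatio {X A : Type*} [MeasurableSpace X]
    (c : X → X → ℝ) (P : A → Measure X) : ℝ≥0∞ :=
  ⨅ (f : A → ℝ → X) (_ : IsCoupling P f), couplingRatio c P f

open Classical in
/-- The `ℓ_p` norm on `ℝⁿ` for an extended real exponent `p ∈ [1,∞]`:
`‖z‖_p = (∑ i |z i|^p)^{1/p}` for finite `p`, and `‖z‖_∞ = max_i |z i|`. -/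
def lpNorm (p : ℝ≥0∞) {n : ℕ} (z : Fin n → ℝ) : ℝ :=
  if p = ⊤ then ⨆ i, |z i| else (∑ i, |z i| ^ p.toReal) ^ (1 / p.toReal)

/-- `V_{m,p} = 2^m Γ(1 + 1/p)^m / Γ(1 + m/p)`: the volume of the unit `ℓ_p` ball in
`ℝ^m` (with the convention `1/p = 0` for `p = ∞`). -/
def unitBallVolume (p : ℝ≥0∞) (m : ℕ) : ℝ :=
  2 ^ m * Real.Gamma (1 + (p⁻¹).toReal) ^ m / Real.Gamma (1 + m * (p⁻¹).toReal)

/-- The optimal pairwise coupling ratio `r*_c(P(ℝⁿ))` of the family of all Borel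
probability measures on `ℝⁿ` for the cost `c(x,y) = ‖x − y‖_p^q`. -/
def lpOptRatio (n : ℕ) (p : ℝ≥0∞) (q : ℝ) : ℝ≥0∞ :=
  optRatio (fun x y : Fin n → ℝ => lpNorm p (x - y) ^ q)
    (fun P : ProbabilityMeasure (Fin n → ℝ) => (P : Measure (Fin n → ℝ)))

/-! ### First hitting times of i.i.d. sequences -/

/-- The first index `k` with `ω k ∈ A` (and `0` if there is none). -/
def firstHit {E : Type*} (A : Set E) (ω : ℕ → E) : ℕ := sInf {k | ω k ∈ A}

lemma firstHit_mem {E : Type*} {A : Set E} {ω : ℕ → E} (h : ∃ k, ω k ∈ A) :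
    ω (firstHit A ω) ∈ A := Nat.sInf_mem (s := {k | ω k ∈ A}) h

lemma notMem_of_lt_firstHit {E : Type*} {A : Set E} {ω : ℕ → E} {j : ℕ}
    (h : j < firstHit A ω) : ω j ∉ A := Nat.notMem_of_lt_sInf (s := {k | ω k ∈ A}) h

lemma firstHit_eq_of {E : Type*} {A : Set E} {ω : ℕ → E} {k : ℕ} (hk : ω k ∈ A)
    (h : ∀ j < k, ω j ∉ A) : firstHit A ω = k := by
  refine le_antisymm (Nat.sInf_le hk) (not_lt.1 fun hlt => h _ hlt (firstHit_mem ⟨k, hk⟩))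

lemma firstHit_eq_zero_of_never {E : Type*} {A : Set E} {ω : ℕ → E} (h : ∀ k, ω k ∉ A) :
    firstHit A ω = 0 := by
  have : {k | ω k ∈ A} = ∅ := by ext k; simpa using h k
  simp [firstHit, this]

lemma measurable_firstHit {E : Type*} [MeasurableSpace E] {A : Set E} (hA : MeasurableSet A) :
    Measurable (firstHit A) := by
  have hev : ∀ k, Measurable fun ω : ℕ → E => ω k := fun k => measurable_pi_apply k
  refine measurable_to_countable' fun k => ?_
  have : firstHit A ⁻¹' {k} =
      {ω : ℕ → E | ω k ∈ A ∧ ∀ j < k, ω j ∉ A} ∪ {ω | k = 0 ∧ ∀ j, ω j ∉ A} := by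
    ext ω
    simp only [Set.mem_preimage, Set.mem_singleton_iff, Set.mem_union, Set.mem_ofPred_eq]
    constructor
    · rintro rfl
      by_cases h : ∃ k, ω k ∈ A
      · exact Or.inl ⟨firstHit_mem h, fun j hj => notMem_of_lt_firstHit hj⟩
      · push Not at h
        exact Or.inr ⟨firstHit_eq_zero_of_never h, h⟩
    · rintro (⟨h1, h2⟩ | ⟨rfl, h⟩)
      · exact firstHit_eq_of h1 h2
      · exact firstHit_eq_zero_of_never h
  rw [this]
  refine MeasurableSet.union ?_ ?_
  · refine (hev k hA).inter (?_ : MeasurableSet {ω : ℕ → E | ∀ j < k, ω j ∉ A})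
    simp only [Set.ofPred_forall]
    exact MeasurableSet.iInter fun j => MeasurableSet.iInter fun _ => hev j hA.compl
  · refine (MeasurableSet.const (k = 0)).inter
      (?_ : MeasurableSet {ω : ℕ → E | ∀ j, ω j ∉ A})
    simp only [Set.ofPred_forall]
    exact MeasurableSet.iInter fun j => hev j hA.compl

/-- If two first hitting times differ, then the first hit of the union lies in the symmetric
difference. -/
lemma exists_first_mem_of_firstHit_ne {E : Type*} {A B : Set E} {ω : ℕ → E}
    (h : firstHit A ω ≠ firstHit B ω) :
    ∃ k, ω k ∈ symmDiff A B ∧ ∀ j < k, ω j ∉ A ∪ B := by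
  have hex : ∃ k, ω k ∈ A ∪ B := by
    by_contra! hc
    refine h ?_
    rw [firstHit_eq_zero_of_never fun k hk => hc k (Or.inl hk),
      firstHit_eq_zero_of_never fun k hk => hc k (Or.inr hk)]
  refine ⟨firstHit (A ∪ B) ω, ?_, fun j hj => notMem_of_lt_firstHit hj⟩
  by_contra hsd
  have hm := firstHit_mem hex
  have hlt : ∀ j < firstHit (A ∪ B) ω, ω j ∉ A ∪ B := fun j hj => notMem_of_lt_firstHit hj
  have hAB : ω (firstHit (A ∪ B) ω) ∈ A ∧ ω (firstHit (A ∪ B) ω) ∈ B := by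
    simp only [Set.mem_symmDiff] at hsd
    rcases hm with hm | hm <;> tauto
  refine h ?_
  rw [firstHit_eq_of hAB.1 fun j hj hjA => hlt j hj (Or.inl hjA),
    firstHit_eq_of hAB.2 fun j hj hjA => hlt j hj (Or.inr hjA)]

lemma infinitePi_forall_lt_notMem {E : Type*} [MeasurableSpace E] (μ : Measure E)
    [IsProbabilityMeasure μ] {A C : Set E} (hA : MeasurableSet A) (hC : MeasurableSet C) (k : ℕ) :
    Measure.infinitePi (fun _ : ℕ => μ) {ω | ω k ∈ C ∧ ∀ j < k, ω j ∉ A} = μ Aᶜ ^ k * μ C := by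
  have : {ω : ℕ → E | ω k ∈ C ∧ ∀ j < k, ω j ∉ A} =
      Set.pi (Finset.range (k + 1)) fun j => if j < k then Aᶜ else C := by
    ext ω
    simp only [Set.mem_ofPred_eq, Set.mem_pi, Finset.coe_range, Set.mem_Iio]
    constructor
    · rintro ⟨h1, h2⟩ j hj
      split_ifs with hjk
      · exact h2 j hjk
      · obtain rfl : j = k := by omega
        exact h1
    · intro h
      refine ⟨by simpa using h k (by omega), fun j hj => ?_⟩
      have := h j (by omega)
      rwa [if_pos hj] at this
  rw [this, Measure.infinitePi_pi _ (by intro j _; split_ifs; exacts [hA.compl, hC]),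
    Finset.prod_range_succ, if_neg (lt_irrefl k)]
  congr 1
  rw [Finset.prod_congr rfl (g := fun _ => μ Aᶜ)]
  · simp
  · intro j hj
    rw [if_pos (Finset.mem_range.1 hj)]

lemma infinitePi_exists_first_mem_le {E : Type*} [MeasurableSpace E] (μ : Measure E)
    [IsProbabilityMeasure μ] {U C : Set E} (hU : MeasurableSet U) (hC : MeasurableSet C) :
    Measure.infinitePi (fun _ : ℕ => μ) {ω | ∃ k, ω k ∈ C ∧ ∀ j < k, ω j ∉ U} ≤ μ C / μ U := by
  rw [Set.ofPred_exists]
  refine (measure_iUnion_le _).trans ?_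
  simp_rw [infinitePi_forall_lt_notMem μ hU hC]
  rw [ENNReal.tsum_mul_right, ENNReal.tsum_geometric, prob_compl_eq_one_sub hU,
    ENNReal.sub_sub_cancel ENNReal.one_ne_top prob_le_one, mul_comm, div_eq_mul_inv]

lemma infinitePi_never_mem {E : Type*} [MeasurableSpace E] (μ : Measure E)
    [IsProbabilityMeasure μ] {A : Set E} (hA : MeasurableSet A) (h0 : μ A ≠ 0) :
    Measure.infinitePi (fun _ : ℕ => μ) {ω | ∀ k, ω k ∉ A} = 0 := by
  have hlt : μ Aᶜ < 1 := by
    rw [prob_compl_eq_one_sub hA]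
    exact ENNReal.sub_lt_self ENNReal.one_ne_top one_ne_zero h0
  refine le_antisymm (ge_of_tendsto' (ENNReal.tendsto_pow_atTop_nhds_zero_of_lt_one hlt)
    fun k => ?_)
    bot_le
  calc _ ≤ Measure.infinitePi (fun _ : ℕ => μ)
        {ω | ω k ∈ Set.univ ∧ ∀ j < k, ω j ∉ A} :=
        measure_mono fun ω (hω : ∀ k, ω k ∉ A) => ⟨Set.mem_univ _, fun j _ => hω j⟩
    _ = μ Aᶜ ^ k := by rw [infinitePi_forall_lt_notMem μ hA MeasurableSet.univ]; simp

lemma infinitePi_firstHit_ne_le {E : Type*} [MeasurableSpace E] (μ : Measure E)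
    [IsProbabilityMeasure μ] {A B : Set E} (hA : MeasurableSet A) (hB : MeasurableSet B) :
    Measure.infinitePi (fun _ : ℕ => μ) {ω | firstHit A ω ≠ firstHit B ω} ≤
      μ (symmDiff A B) / μ A :=
  calc _ ≤ Measure.infinitePi (fun _ : ℕ => μ)
        {ω | ∃ k, ω k ∈ symmDiff A B ∧ ∀ j < k, ω j ∉ A ∪ B} :=
        measure_mono fun _ hω => exists_first_mem_of_firstHit_ne hω
    _ ≤ μ (symmDiff A B) / μ (A ∪ B) :=
        infinitePi_exists_first_mem_le μ (hA.union hB) (hA.symmDiff hB)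
    _ ≤ _ := ENNReal.div_le_div_left (measure_mono Set.subset_union_left) _

/-! ### Simultaneous sampling from all distributions on a finite set -/

instance : IsProbabilityMeasure stdSpace := ⟨by simp [stdSpace]⟩

lemma stdSpace_Ico {p : ℝ} (h1 : p ≤ 1) : stdSpace (Set.Ico 0 p) = ENNReal.ofReal p := by
  rw [stdSpace, Measure.restrict_apply measurableSet_Ico, Set.inter_eq_left.2, Real.volume_Ico,
    sub_zero]
  exact fun x hx => ⟨hx.1, hx.2.le.trans h1⟩

lemma stdSpace_symmDiff_Ico_le (p q : ℝ) :
    stdSpace (symmDiff (Set.Ico 0 p) (Set.Ico 0 q)) ≤ ENNReal.ofReal |p - q| := by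
  rw [stdSpace]
  refine (Measure.restrict_apply_le _ _).trans ?_
  calc volume (symmDiff (Set.Ico 0 p) (Set.Ico 0 q)) ≤ volume (Set.Ico (min p q) (max p q)) := by
        refine measure_mono fun x hx => ?_
        simp only [Set.mem_symmDiff, Set.mem_Ico, not_and, not_lt] at hx ⊢
        rcases hx with ⟨a, b⟩ | ⟨a, b⟩
        · exact ⟨(min_le_right _ _).trans (b a.1), lt_max_of_lt_left a.2⟩
        · exact ⟨(min_le_left _ _).trans (b a.1), lt_max_of_lt_right a.2⟩
    _ = _ := by rw [Real.volume_Ico, max_sub_min_eq_abs']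

/-- Uniform proposals `(ℓ, u) ∈ Λ × [0,1]` for rejection sampling. -/
def proposal (Λ : Type) [Fintype Λ] [Nonempty Λ] [MeasurableSpace Λ] : Measure (Λ × ℝ) :=
  (PMF.uniformOfFintype Λ).toMeasure.prod stdSpace

/-- The proposals accepted for the distribution proportional to the weights `w`. -/
def acceptSet {Λ : Type} [Fintype Λ] (w : Λ → ℝ) : Set (Λ × ℝ) :=
  {z | 0 ≤ z.2 ∧ z.2 < w z.1 / ∑ l, w l}

lemma measurableSet_acceptSet {Λ : Type} [Fintype Λ] [MeasurableSpace Λ]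
    [DiscreteMeasurableSpace Λ] (w : Λ → ℝ) : MeasurableSet (acceptSet w) := by
  refine (measurableSet_le measurable_const measurable_snd).inter
    (measurableSet_lt measurable_snd ?_)
  exact (measurable_of_countable fun l => w l / ∑ l, w l).comp measurable_fst

open Classical in
/-- Rejection sampling from the distribution proportional to `w`, with a positive-weight default
in case no proposal is ever accepted. -/
def rejectionSample {Λ : Type} [Fintype Λ] [Nonempty Λ] (w : Λ → ℝ) (ω : ℕ → Λ × ℝ) : Λ :=
  if ∃ k, ω k ∈ acceptSet w then (ω (firstHit (acceptSet w) ω)).1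
  else Classical.epsilon fun l => 0 < w l

lemma rejectionSample_pos {Λ : Type} [Fintype Λ] [Nonempty Λ] {w : Λ → ℝ}
    (hs : 0 < ∑ l, w l) (ω : ℕ → Λ × ℝ) : 0 < w (rejectionSample w ω) := by
  unfold rejectionSample
  split_ifs with h
  · have := firstHit_mem h
    have h2 := this.1.trans_lt this.2
    exact (div_pos_iff_of_pos_right hs).1 h2
  · have : ∃ l, 0 < w l := by
      by_contra! hc
      exact absurd (Finset.sum_nonpos fun l _ => hc l) (not_le.2 hs)
    exact Classical.epsilon_spec this

section Sampler

variable {Λ : Type} [Fintype Λ] [Nonempty Λ] [MeasurableSpace Λ] [DiscreteMeasurableSpace Λ]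

instance : IsProbabilityMeasure (proposal Λ) := by unfold proposal; infer_instance

lemma proposal_apply {C : Set (Λ × ℝ)} (hC : MeasurableSet C) :
    proposal Λ C = (Fintype.card Λ : ℝ≥0∞)⁻¹ * ∑ l, stdSpace (Prod.mk l ⁻¹' C) := by
  rw [proposal, Measure.prod_apply hC, lintegral_fintype, Finset.mul_sum]
  refine Finset.sum_congr rfl fun l _ => ?_
  rw [PMF.toMeasure_apply_singleton _ _ (measurableSet_singleton l), PMF.uniformOfFintype_apply,
    mul_comm]

lemma proposal_acceptSet_inter {w : Λ → ℝ} (hw : ∀ l, 0 ≤ w l) (s : Set Λ) [DecidablePred (· ∈ s)] :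
    proposal Λ (acceptSet w ∩ Prod.fst ⁻¹' s) = (Fintype.card Λ : ℝ≥0∞)⁻¹ *
      ENNReal.ofReal (∑ l, if l ∈ s then w l / ∑ l, w l else 0) := by
  have h0 : ∀ l, 0 ≤ w l / ∑ l, w l := fun l =>
    div_nonneg (hw l) (Finset.sum_nonneg fun i _ => hw i)
  rw [proposal_apply ((measurableSet_acceptSet w).inter
      (measurable_fst (Set.toFinite s).measurableSet)),
    ENNReal.ofReal_sum_of_nonneg (fun l _ => by split_ifs; exacts [h0 l, le_rfl])]
  congr 1
  refine Finset.sum_congr rfl fun l _ => ?_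
  split_ifs with hl
  · rw [← stdSpace_Ico (p := w l / ∑ l, w l) ?_]
    · congr 1; ext u; simp [acceptSet, hl]
    · exact div_le_one_of_le₀ (Finset.single_le_sum (fun i _ => hw i) (Finset.mem_univ l))
        (Finset.sum_nonneg fun i _ => hw i)
  · have : Prod.mk l ⁻¹' (acceptSet w ∩ Prod.fst ⁻¹' s) = (∅ : Set ℝ) := by
      ext u; simp [hl]
    simp [this]

lemma proposal_acceptSet {w : Λ → ℝ} (hw : ∀ l, 0 ≤ w l) (hs : 0 < ∑ l, w l) :
    proposal Λ (acceptSet w) = (Fintype.card Λ : ℝ≥0∞)⁻¹ := by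
  classical
  have := proposal_acceptSet_inter hw Set.univ
  simpa [← Finset.sum_div, div_self hs.ne'] using this

lemma proposal_acceptSet_ne_zero {w : Λ → ℝ} (hw : ∀ l, 0 ≤ w l) (hs : 0 < ∑ l, w l) :
    proposal Λ (acceptSet w) ≠ 0 := by
  rw [proposal_acceptSet hw hs]
  simp

lemma measurable_rejectionSample (w : Λ → ℝ) : Measurable (rejectionSample w) := by
  have hA := measurableSet_acceptSet w
  refine Measurable.ite ?_ ?_ measurable_const
  · simp only [Set.ofPred_exists]
    exact MeasurableSet.iUnion fun k => measurable_pi_apply k hA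
  · have : Measurable fun z : (ℕ → Λ × ℝ) × ℕ => (z.1 z.2).1 :=
      measurable_from_prod_countable_left fun k => measurable_fst.comp (measurable_pi_apply k)
    exact this.comp (measurable_id.prodMk (measurable_firstHit hA))

lemma ae_exists_accept {w : Λ → ℝ} (hw : ∀ l, 0 ≤ w l) (hs : 0 < ∑ l, w l) :
    ∀ᵐ ω ∂Measure.infinitePi (fun _ : ℕ => proposal Λ), ∃ k, ω k ∈ acceptSet w := by
  rw [ae_iff]
  simpa using infinitePi_never_mem (proposal Λ) (measurableSet_acceptSet w)
    (proposal_acceptSet_ne_zero hw hs)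

lemma infinitePi_rejectionSample_le {w : Λ → ℝ} (hw : ∀ l, 0 ≤ w l) (hs : 0 < ∑ l, w l) (l : Λ) :
    (Measure.infinitePi (fun _ : ℕ => proposal Λ)) {ω | rejectionSample w ω = l} ≤
      ENNReal.ofReal (w l / ∑ l, w l) := by
  classical
  have hA := measurableSet_acceptSet w
  calc _ ≤ (Measure.infinitePi (fun _ : ℕ => proposal Λ))
        {ω | ∃ k, ω k ∈ acceptSet w ∩ Prod.fst ⁻¹' {l} ∧ ∀ j < k, ω j ∉ acceptSet w} := by
        refine measure_mono_ae ?_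
        filter_upwards [ae_exists_accept hw hs] with ω hω hl
        replace hl : rejectionSample w ω = l := hl
        rw [rejectionSample, if_pos hω] at hl
        exact ⟨_, ⟨firstHit_mem hω, hl⟩, fun j hj => notMem_of_lt_firstHit hj⟩
    _ ≤ proposal Λ (acceptSet w ∩ Prod.fst ⁻¹' {l}) / proposal Λ (acceptSet w) :=
        infinitePi_exists_first_mem_le _ hA (hA.inter (measurable_fst (measurableSet_singleton l)))
    _ = _ := by
        rw [proposal_acceptSet hw hs, proposal_acceptSet_inter hw, ENNReal.div_eq_inv_mul,
          ← mul_assoc, ENNReal.inv_mul_cancel (by simp) (by simp), one_mul]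
        simp

lemma infinitePi_rejectionSample_eq {w : Λ → ℝ} (hw : ∀ l, 0 ≤ w l) (hs : 0 < ∑ l, w l) (l : Λ) :
    (Measure.infinitePi (fun _ : ℕ => proposal Λ)).real {ω | rejectionSample w ω = l} =
      w l / ∑ l, w l := by
  set μ := Measure.infinitePi (fun _ : ℕ => proposal Λ)
  have hle : ∀ l ∈ Finset.univ, μ.real {ω | rejectionSample w ω = l} ≤ w l / ∑ l, w l :=
    fun l _ => ENNReal.toReal_le_of_le_ofReal (div_nonneg (hw l) hs.le)
      (infinitePi_rejectionSample_le hw hs l)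
  refine (Finset.sum_eq_sum_iff_of_le hle).1 ?_ l (Finset.mem_univ l)
  rw [← Finset.sum_div, div_self hs.ne']
  have := sum_measureReal_preimage_singleton (μ := μ) (f := rejectionSample w) Finset.univ
    (fun y _ => measurable_rejectionSample w (measurableSet_singleton y))
  exact this.trans (by simp)

lemma infinitePi_rejectionSample_ne_le {w v : Λ → ℝ} (hw : ∀ l, 0 ≤ w l) (hs : 0 < ∑ l, w l)
    (hv : ∀ l, 0 ≤ v l) (hs' : 0 < ∑ l, v l) :
    (Measure.infinitePi (fun _ : ℕ => proposal Λ)).real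
        {ω | rejectionSample w ω ≠ rejectionSample v ω} ≤
      ∑ l, |w l / ∑ l, w l - v l / ∑ l, v l| := by
  have hA := measurableSet_acceptSet w
  have hB := measurableSet_acceptSet v
  refine ENNReal.toReal_le_of_le_ofReal (Finset.sum_nonneg fun _ _ => abs_nonneg _) ?_
  calc _ ≤ (Measure.infinitePi (fun _ : ℕ => proposal Λ))
        {ω | firstHit (acceptSet w) ω ≠ firstHit (acceptSet v) ω} := by
        refine measure_mono_ae ?_
        filter_upwards [ae_exists_accept hw hs, ae_exists_accept hv hs'] with ω h1 h2 hne heq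
        refine hne ?_
        rw [rejectionSample, rejectionSample, if_pos h1, if_pos h2, heq]
    _ ≤ proposal Λ (symmDiff (acceptSet w) (acceptSet v)) / proposal Λ (acceptSet w) :=
        infinitePi_firstHit_ne_le _ hA hB
    _ = ∑ l, stdSpace (Prod.mk l ⁻¹' symmDiff (acceptSet w) (acceptSet v)) := by
        rw [proposal_acceptSet hw hs, proposal_apply (hA.symmDiff hB), ENNReal.div_eq_inv_mul,
          ← mul_assoc, ENNReal.inv_mul_cancel (by simp) (by simp), one_mul]
    _ ≤ ∑ l, ENNReal.ofReal |w l / ∑ l, w l - v l / ∑ l, v l| := by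
        refine Finset.sum_le_sum fun l _ => ?_
        exact stdSpace_symmDiff_Ico_le _ _
    _ = _ := (ENNReal.ofReal_sum_of_nonneg fun _ _ => abs_nonneg _).symm

end Sampler

/-! ### Hierarchical sampling along a sequence of partitions -/

/-- The part of the vector `z` living on the cell with label `l` of the partition given by `L`. -/
def cellPart {X : Type} [DecidableEq X] (L : X → X) (l : X) : (X → ℝ) →ₗ[ℝ] (X → ℝ) where
  toFun z x := if L x = l then z x else 0
  map_add' z z' := by ext x; simp only [Pi.add_apply]; split_ifs <;> simp
  map_smul' c z := by ext x; simp

/-- The total mass of a vector. -/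
def totalMass (X : Type) [Fintype X] : (X → ℝ) →ₗ[ℝ] ℝ := ∑ x, LinearMap.proj x

lemma totalMass_apply {X : Type} [Fintype X] (z : X → ℝ) : totalMass X z = ∑ x, z x := by
  simp [totalMass]

lemma cellPart_apply {X : Type} [DecidableEq X] (L : X → X) (l : X) (z : X → ℝ) (x : X) :
    cellPart L l z x = if L x = l then z x else 0 := rfl

/-- The cost of sampling a label of the partition `L` (at unit diameter). -/
def levelCost {X : Type} [Fintype X] [DecidableEq X] (L : X → X) : Seminorm ℝ (X → ℝ) :=
  ∑ l, (normSeminorm ℝ ℝ).comp (totalMass X ∘ₗ cellPart L l) +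
    (normSeminorm ℝ ℝ).comp (totalMass X)

/-- The cost of sampling along the first `N` partitions of the sequence `L`, with diameters
decreasing by a factor of `4` at each level, and then sampling a point. -/
def treeCost {X : Type} [Fintype X] [DecidableEq X] : ℕ → (ℕ → X → X) → Seminorm ℝ (X → ℝ)
  | 0, _ => levelCost id
  | N + 1, L => levelCost (L 0) +
      (4⁻¹ : NNReal) • ∑ l, (treeCost N fun k => L (k + 1)).comp (cellPart (L 0) l)

lemma integral_ite_one_zero {Ω : Type} [MeasurableSpace Ω] {μ : Measure Ω} {p : Ω → Prop}
    [DecidablePred p] (hp : MeasurableSet {ω | p ω}) :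
    ∫ ω, (if p ω then (1 : ℝ) else 0) ∂μ = μ.real {ω | p ω} := by
  rw [← integral_indicator_one hp]
  refine integral_congr_ae (.of_forall fun ω => ?_)
  by_cases h : p ω <;> simp [h]

section Tree

variable {X : Type} [Fintype X] [DecidableEq X]

lemma levelCost_apply (L : X → X) (z : X → ℝ) :
    levelCost L z = ∑ l, |∑ x, cellPart L l z x| + |∑ x, z x| := by
  simp [levelCost, totalMass_apply, Seminorm.comp_apply]

lemma treeCost_zero_apply (L : ℕ → X → X) (z : X → ℝ) :
    treeCost 0 L z = levelCost id z := rfl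

lemma treeCost_succ_apply (N : ℕ) (L : ℕ → X → X) (z : X → ℝ) :
    treeCost (N + 1) L z = levelCost (L 0) z +
      4⁻¹ * ∑ l, treeCost N (fun k => L (k + 1)) (cellPart (L 0) l z) := by
  simp [treeCost, Seminorm.comp_apply, NNReal.smul_def]

lemma sum_sum_cellPart (L : X → X) (z : X → ℝ) : ∑ l, ∑ x, cellPart L l z x = ∑ x, z x := by
  rw [Finset.sum_comm]
  simp [cellPart_apply]

omit [Fintype X] in
lemma cellPart_nonneg (L : X → X) (l : X) {w : X → ℝ} (hw : ∀ x, 0 ≤ w x) (x : X) :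
    0 ≤ cellPart L l w x := by
  rw [cellPart_apply]; split_ifs; exacts [hw x, le_rfl]

omit [DecidableEq X] in
/-- Comparison of normalized and unnormalized differences of nonnegative weights. -/
lemma min_mul_sum_abs_div_sub_div_le {w v : X → ℝ} (hw : ∀ x, 0 ≤ w x) (hs : 0 < ∑ x, w x)
    (hv : ∀ x, 0 ≤ v x) (hs' : 0 < ∑ x, v x) :
    min (∑ x, w x) (∑ x, v x) * ∑ x, |w x / ∑ x, w x - v x / ∑ x, v x| ≤
      ∑ x, |w x - v x| + |∑ x, w x - ∑ x, v x| := by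
  wlog hle : ∑ x, w x ≤ ∑ x, v x generalizing w v
  · have := this hv hs' hw hs (not_le.1 hle).le
    rw [min_comm, abs_sub_comm (∑ x, w x)]
    simp_rw [abs_sub_comm (w _ / _), abs_sub_comm (w _)]
    exact this
  set a := ∑ x, w x
  set b := ∑ x, v x with hb
  rw [min_eq_left hle, Finset.mul_sum]
  have h1 : ∀ x, a * |w x / a - v x / b| ≤ |w x - v x| + v x / b * (b - a) := by
    intro x
    rw [← abs_of_pos hs, ← abs_mul, abs_of_pos hs]
    have : a * (w x / a - v x / b) = (w x - v x) + v x / b * (b - a) := by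
      field_simp; ring
    rw [this]
    refine (abs_add_le _ _).trans_eq ?_
    rw [abs_of_nonneg (mul_nonneg (div_nonneg (hv x) hs'.le) (sub_nonneg.2 hle))]
  refine (Finset.sum_le_sum fun x _ => h1 x).trans_eq ?_
  rw [Finset.sum_add_distrib, ← Finset.sum_mul, ← Finset.sum_div, ← hb, div_self hs'.ne', one_mul,
    abs_sub_comm a b, abs_of_nonneg (sub_nonneg.2 hle)]

/-- The cost of one sampling step from label weights is controlled by `levelCost`. -/
lemma min_mul_sum_cell_le_levelCost (L : X → X) {w v : X → ℝ} (hw : ∀ x, 0 ≤ w x)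
    (hs : 0 < ∑ x, w x) (hv : ∀ x, 0 ≤ v x) (hs' : 0 < ∑ x, v x) :
    min (∑ x, w x) (∑ x, v x) *
      ∑ l, |(∑ x, cellPart L l w x) / ∑ x, w x - (∑ x, cellPart L l v x) / ∑ x, v x| ≤
      levelCost L (w - v) := by
  have := min_mul_sum_abs_div_sub_div_le (w := fun l => ∑ x, cellPart L l w x)
    (v := fun l => ∑ x, cellPart L l v x)
    (fun l => Finset.sum_nonneg fun x _ => cellPart_nonneg L l hw x)
    (by rwa [sum_sum_cellPart])
    (fun l => Finset.sum_nonneg fun x _ => cellPart_nonneg L l hv x)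
    (by rwa [sum_sum_cellPart])
  simp only [sum_sum_cellPart] at this
  rw [levelCost_apply]
  simpa [map_sub, Finset.sum_sub_distrib] using this

variable [MeasurableSpace X] [DiscreteMeasurableSpace X]

omit [DecidableEq X] in
lemma integrable_comp_pair {Ω : Type} [MeasurableSpace Ω] (μ : Measure Ω) [IsFiniteMeasure μ]
    {A B : Ω → X} (hA : Measurable A) (hB : Measurable B) (d : X → X → ℝ) :
    Integrable (fun ω => d (A ω) (B ω)) μ :=
  (Integrable.of_finite (μ := μ.map fun ω => (A ω, B ω))
    (f := fun z : X × X => d z.1 z.2)).comp_measurable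
    (hA.prodMk hB)

/-- `(Ω, μ, Y)` samples from all weights on `X` simultaneously: `Y w` has law proportional
to `w`, and two samples are close on average, as measured by `treeCost N L`. -/
structure IsTreeSampler (N : ℕ) (L : ℕ → X → X) {Ω : Type} [MeasurableSpace Ω] (μ : Measure Ω)
    (Y : (X → ℝ) → Ω → X) : Prop where
  measurable : ∀ w, Measurable (Y w)
  pos : ∀ w : X → ℝ, (∀ x, 0 ≤ w x) → 0 < ∑ x, w x → ∀ ω, 0 < w (Y w ω)
  law : ∀ w : X → ℝ, (∀ x, 0 ≤ w x) → 0 < ∑ x, w x → ∀ x, μ.real {ω | Y w ω = x} = w x / ∑ x, w x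
  cost : ∀ (d : X → X → ℝ) (D : ℝ), 0 ≤ D → (∀ x y, 0 ≤ d x y) → (∀ x, d x x = 0) →
    (∀ k < N, ∀ x y, L k x = L k y → d x y ≤ D / 4 ^ (k + 1)) →
    ∀ w v : X → ℝ, (∀ x, 0 ≤ w x) → 0 < ∑ x, w x → (∀ x, 0 ≤ v x) → 0 < ∑ x, v x →
    (∀ x y, 0 < w x → 0 < v y → d x y ≤ D) →
    min (∑ x, w x) (∑ x, v x) * ∫ ω, d (Y w ω) (Y v ω) ∂μ ≤ D * treeCost N L (w - v)

lemma isTreeSampler_zero [Nonempty X] (L : ℕ → X → X) :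
    IsTreeSampler 0 L (Measure.infinitePi fun _ : ℕ => proposal X) rejectionSample where
  measurable := measurable_rejectionSample
  pos w _ hs ω := rejectionSample_pos hs ω
  law w hw hs x := infinitePi_rejectionSample_eq hw hs x
  cost d D hD hd hdd _ w v hw hs hv hs' hsupp := by
    set μ := Measure.infinitePi fun _ : ℕ => proposal X
    have hmeas : MeasurableSet {ω : ℕ → X × ℝ | rejectionSample w ω ≠ rejectionSample v ω} :=
      (measurableSet_eq_fun (measurable_rejectionSample w) (measurable_rejectionSample v)).compl
    have h1 : ∫ ω, d (rejectionSample w ω) (rejectionSample v ω) ∂μ ≤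
        D * μ.real {ω | rejectionSample w ω ≠ rejectionSample v ω} := by
      rw [mul_comm, ← smul_eq_mul, ← integral_indicator_const D hmeas]
      refine integral_mono (integrable_comp_pair μ (measurable_rejectionSample w)
        (measurable_rejectionSample v) d)
        ((integrable_const D).indicator hmeas) fun ω => ?_
      by_cases h : rejectionSample w ω = rejectionSample v ω
      · simp [h, hdd]
      · rw [Set.indicator_of_mem (by exact h)]
        exact hsupp _ _ (rejectionSample_pos hs ω) (rejectionSample_pos hs' ω)
    have h2 := infinitePi_rejectionSample_ne_le hw hs hv hs'
    have h3 := min_mul_sum_cell_le_levelCost id hw hs hv hs'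
    have h4 : ∀ (z : X → ℝ) l, ∑ x, cellPart id l z x = z l := fun z l => by simp [cellPart_apply]
    simp only [h4] at h3
    rw [treeCost_zero_apply]
    have hm : 0 ≤ min (∑ x, w x) (∑ x, v x) := le_min hs.le hs'.le
    calc _ ≤ min (∑ x, w x) (∑ x, v x) *
          (D * ∑ l, |w l / ∑ x, w x - v l / ∑ x, v x|) := by gcongr; exact h1.trans (by gcongr)
      _ = D * (min (∑ x, w x) (∑ x, v x) * ∑ l, |w l / ∑ x, w x - v l / ∑ x, v x|) := by ring
      _ ≤ _ := by gcongr

/-- Sample a label of the partition `L`, then sample inside the chosen cell. -/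
def cellSample {Ω₁ Ω₂ : Type} (L : X → X) (Y₁ : (X → ℝ) → Ω₁ → X) (Y₂ : (X → ℝ) → Ω₂ → X)
    (w : X → ℝ) (ω : Ω₁ × Ω₂) : X :=
  Y₂ (cellPart L (Y₁ (fun l => ∑ x, cellPart L l w x) ω.1) w) ω.2

section Step

variable {Ω₁ Ω₂ : Type} [MeasurableSpace Ω₁] [MeasurableSpace Ω₂] {μ₂ : Measure Ω₂}
  {Y₁ : (X → ℝ) → Ω₁ → X} {Y₂ : (X → ℝ) → Ω₂ → X}

lemma measurable_cellSample (L : X → X) (h₁ : ∀ w, Measurable (Y₁ w)) (h₂ : ∀ w, Measurable (Y₂ w))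
    (w : X → ℝ) : Measurable (cellSample L Y₁ Y₂ w) := by
  have : Measurable fun z : X × Ω₂ => Y₂ (cellPart L z.1 w) z.2 :=
    measurable_from_prod_countable_right fun l => h₂ (cellPart L l w)
  exact this.comp (((h₁ _).comp measurable_fst).prodMk measurable_snd)

omit [DiscreteMeasurableSpace X] [MeasurableSpace Ω₁] in
lemma cellSample_spec {N : ℕ} {L' : ℕ → X → X} (L : X → X)
    (hpos₁ : ∀ w : X → ℝ, (∀ x, 0 ≤ w x) → 0 < ∑ x, w x → ∀ ω, 0 < w (Y₁ w ω))
    (h₂ : IsTreeSampler N L' μ₂ Y₂) {w : X → ℝ} (hw : ∀ x, 0 ≤ w x) (hs : 0 < ∑ x, w x)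
    (ω : Ω₁ × Ω₂) :
    0 < w (cellSample L Y₁ Y₂ w ω) ∧
      L (cellSample L Y₁ Y₂ w ω) = Y₁ (fun l => ∑ x, cellPart L l w x) ω.1 := by
  have hp := hpos₁ (fun l => ∑ x, cellPart L l w x)
    (fun l => Finset.sum_nonneg fun x _ => cellPart_nonneg L l hw x)
    (by rwa [sum_sum_cellPart]) ω.1
  have := h₂.pos _ (cellPart_nonneg L _ hw) hp ω.2
  rw [cellPart_apply] at this
  split_ifs at this with h
  · exact ⟨this, h⟩
  · exact absurd this (lt_irrefl _)

end Step

lemma IsTreeSampler.succ [Nonempty X] {N : ℕ} {L : ℕ → X → X} {Ω₂ : Type} [MeasurableSpace Ω₂]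
    {μ₂ : Measure Ω₂} [IsProbabilityMeasure μ₂] {Y₂ : (X → ℝ) → Ω₂ → X}
    (h₂ : IsTreeSampler N (fun k => L (k + 1)) μ₂ Y₂) :
    IsTreeSampler (N + 1) L ((Measure.infinitePi fun _ : ℕ => proposal X).prod μ₂)
      (cellSample (L 0) rejectionSample Y₂) where
  measurable := measurable_cellSample (L 0) measurable_rejectionSample h₂.measurable
  pos w hw hs ω :=
    (cellSample_spec (L 0) (fun w _ hs ω => rejectionSample_pos hs ω) h₂ hw hs ω).1
  law w hw hs x := by
    set μ₁ := Measure.infinitePi fun _ : ℕ => proposal X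
    have hspec := cellSample_spec (Y₁ := rejectionSample) (L 0)
      (fun w _ hs ω => rejectionSample_pos hs ω) h₂ hw hs
    set W : X → ℝ := fun l => ∑ x, cellPart (L 0) l w x with hW
    have hW0 : ∀ l, 0 ≤ W l := fun l => Finset.sum_nonneg fun x _ => cellPart_nonneg (L 0) l hw x
    have hWs : ∑ l, W l = ∑ x, w x := sum_sum_cellPart (L 0) w
    have hset : {ω | cellSample (L 0) rejectionSample Y₂ w ω = x} =
        {ω | rejectionSample W ω = L 0 x} ×ˢ {ω | Y₂ (cellPart (L 0) (L 0 x) w) ω = x} := by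
      ext ⟨ω₁, ω₂⟩
      simp only [Set.mem_ofPred_eq, Set.mem_prod]
      constructor
      · intro h
        have h1 := (hspec (ω₁, ω₂)).2
        rw [h] at h1
        refine ⟨h1.symm, ?_⟩
        rw [h1]; exact h
      · rintro ⟨h1, h2⟩
        rw [← h1] at h2
        exact h2
    rw [hset, measureReal_prod_prod,
      infinitePi_rejectionSample_eq hW0 (hWs ▸ hs), hWs]
    rcases (hW0 (L 0 x)).eq_or_lt with h0 | h0
    · have : w x = 0 := by
        have := (Finset.sum_eq_zero_iff_of_nonneg
          (fun y _ => cellPart_nonneg (L 0) (L 0 x) hw y)).1 h0.symm x (Finset.mem_univ x)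
        simpa [cellPart_apply] using this
      simp [← h0, this]
    · rw [h₂.law _ (cellPart_nonneg (L 0) _ hw) h0]
      have : cellPart (L 0) (L 0 x) w x = w x := by simp [cellPart_apply]
      rw [this]
      change W (L 0 x) / _ * (w x / W (L 0 x)) = _
      field_simp
  cost d D hD hd hdd hL w v hw hs hv hs' hsupp := by
    set μ₁ := Measure.infinitePi fun _ : ℕ => proposal X
    have hspecw := cellSample_spec (Y₁ := rejectionSample) (L 0)
      (fun w _ hs ω => rejectionSample_pos hs ω) h₂ hw hs
    have hspecv := cellSample_spec (Y₁ := rejectionSample) (L 0)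
      (fun w _ hs ω => rejectionSample_pos hs ω) h₂ hv hs'
    have hcost := min_mul_sum_cell_le_levelCost (L 0) hw hs hv hs'
    set W : X → ℝ := fun l => ∑ x, cellPart (L 0) l w x with hW
    set V : X → ℝ := fun l => ∑ x, cellPart (L 0) l v x with hV
    have hW0 : ∀ l, 0 ≤ W l := fun l => Finset.sum_nonneg fun x _ => cellPart_nonneg (L 0) l hw x
    have hV0 : ∀ l, 0 ≤ V l := fun l => Finset.sum_nonneg fun x _ => cellPart_nonneg (L 0) l hv x
    have hWs : ∑ l, W l = ∑ x, w x := sum_sum_cellPart (L 0) w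
    have hVs : ∑ l, V l = ∑ x, v x := sum_sum_cellPart (L 0) v
    set a := ∑ x, w x with ha
    set b := ∑ x, v x with hb
    have hm : 0 ≤ min a b := le_min hs.le hs'.le
    have hmW := measurable_rejectionSample W
    have hmV := measurable_rejectionSample V
    set f : X → (ℕ → X × ℝ) → ℝ := fun l ω₁ =>
      if rejectionSample W ω₁ = l ∧ rejectionSample V ω₁ = l then 1 else 0 with hf
    set g : X → Ω₂ → ℝ := fun l ω₂ =>
      d (Y₂ (cellPart (L 0) l w) ω₂) (Y₂ (cellPart (L 0) l v) ω₂) with hg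
    set e : (ℕ → X × ℝ) → ℝ := fun ω₁ =>
      if rejectionSample W ω₁ ≠ rejectionSample V ω₁ then 1 else 0 with he
    have hfi : ∀ l, Integrable (f l) μ₁ := fun l =>
      integrable_comp_pair μ₁ hmW hmV fun x y => if x = l ∧ y = l then 1 else 0
    have hei : Integrable e μ₁ := integrable_comp_pair μ₁ hmW hmV fun x y => if x ≠ y then 1 else 0
    have hgi : ∀ l, Integrable (g l) μ₂ := fun l =>
      integrable_comp_pair μ₂ (h₂.measurable _) (h₂.measurable _) d
    have hbound : ∫ ω, d (cellSample (L 0) rejectionSample Y₂ w ω)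
        (cellSample (L 0) rejectionSample Y₂ v ω) ∂(μ₁.prod μ₂) ≤
        D * ∫ ω₁, e ω₁ ∂μ₁ + ∑ l, (∫ ω₁, f l ω₁ ∂μ₁) * ∫ ω₂, g l ω₂ ∂μ₂ := by
      have hi1 : Integrable (fun ω : (ℕ → X × ℝ) × Ω₂ => D * e ω.1) (μ₁.prod μ₂) :=
        (hei.comp_fst μ₂).const_mul D
      have hi2 : ∀ l, Integrable (fun ω : (ℕ → X × ℝ) × Ω₂ => f l ω.1 * g l ω.2) (μ₁.prod μ₂) :=
        fun l => (hfi l).mul_prod (hgi l)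
      have heq : D * ∫ ω₁, e ω₁ ∂μ₁ + ∑ l, (∫ ω₁, f l ω₁ ∂μ₁) * ∫ ω₂, g l ω₂ ∂μ₂ =
          ∫ ω, (D * e ω.1 + ∑ l, f l ω.1 * g l ω.2) ∂(μ₁.prod μ₂) := by
        rw [integral_add hi1 (integrable_finsetSum _ fun l _ => hi2 l),
          integral_finsetSum _ fun l _ => hi2 l, integral_const_mul, integral_fun_fst]
        simp_rw [integral_prod_mul]
        simp
      rw [heq]
      refine integral_mono (integrable_comp_pair _
        (measurable_cellSample (L 0) measurable_rejectionSample h₂.measurable w)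
        (measurable_cellSample (L 0) measurable_rejectionSample h₂.measurable v) d)
        (hi1.add (integrable_finsetSum _ fun l _ => hi2 l)) fun ω => ?_
      have hnn : ∀ l, 0 ≤ f l ω.1 * g l ω.2 := fun l =>
        mul_nonneg (by rw [hf]; positivity) (hd _ _)
      change d _ _ ≤ D * e ω.1 + ∑ l, f l ω.1 * g l ω.2
      by_cases h : rejectionSample W ω.1 = rejectionSample V ω.1
      · have hsingle := Finset.single_le_sum (fun l _ => hnn l)
          (Finset.mem_univ (rejectionSample V ω.1))
        have he0 : e ω.1 = 0 := by simp [he, h]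
        have hf1 : f (rejectionSample V ω.1) ω.1 = 1 := by simp [hf, h]
        rw [hf1, one_mul] at hsingle
        rw [he0, mul_zero, zero_add]
        refine le_trans (le_of_eq ?_) hsingle
        change d (Y₂ (cellPart (L 0) (rejectionSample W ω.1) w) ω.2)
          (Y₂ (cellPart (L 0) (rejectionSample V ω.1) v) ω.2) = _
        rw [h]
      · refine le_trans ?_ (le_add_of_nonneg_right (Finset.sum_nonneg fun l _ => hnn l))
        rw [he]
        simp only [ne_eq, h, not_false_eq_true, if_true, mul_one]
        exact hsupp _ _ (hspecw ω).1 (hspecv ω).1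
    have hE : min a b * ∫ ω₁, e ω₁ ∂μ₁ ≤ levelCost (L 0) (w - v) := by
      have h1 := infinitePi_rejectionSample_ne_le hW0 (hWs ▸ hs) hV0 (hVs ▸ hs')
      rw [hWs, hVs] at h1
      have h2 : ∫ ω₁, e ω₁ ∂μ₁ = μ₁.real {ω | rejectionSample W ω ≠ rejectionSample V ω} :=
        integral_ite_one_zero (measurableSet_eq_fun hmW hmV).compl
      rw [h2]
      exact (mul_le_mul_of_nonneg_left h1 hm).trans hcost
    have hF : ∀ l, min a b * ((∫ ω₁, f l ω₁ ∂μ₁) * ∫ ω₂, g l ω₂ ∂μ₂) ≤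
        D / 4 * treeCost N (fun k => L (k + 1)) (cellPart (L 0) l (w - v)) := by
      intro l
      have hG0 : 0 ≤ ∫ ω₂, g l ω₂ ∂μ₂ := integral_nonneg fun _ => hd _ _
      have hmeas1 : MeasurableSet {ω | rejectionSample W ω = l} := hmW (measurableSet_singleton l)
      have hmeas2 : MeasurableSet {ω | rejectionSample V ω = l} := hmV (measurableSet_singleton l)
      have hFeq : ∫ ω₁, f l ω₁ ∂μ₁ =
          μ₁.real {ω | rejectionSample W ω = l ∧ rejectionSample V ω = l} :=
        integral_ite_one_zero (hmeas1.inter hmeas2)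
      have hF1 : ∫ ω₁, f l ω₁ ∂μ₁ ≤ W l / a := by
        rw [hFeq, ← hWs, ← infinitePi_rejectionSample_eq hW0 (hWs ▸ hs) l]
        exact measureReal_mono fun ω h => h.1
      have hF2 : ∫ ω₁, f l ω₁ ∂μ₁ ≤ V l / b := by
        rw [hFeq, ← hVs, ← infinitePi_rejectionSample_eq hV0 (hVs ▸ hs') l]
        exact measureReal_mono fun ω h => h.2
      have hmF : min a b * ∫ ω₁, f l ω₁ ∂μ₁ ≤ min (W l) (V l) := by
        have hF0 : 0 ≤ ∫ ω₁, f l ω₁ ∂μ₁ := hFeq ▸ measureReal_nonneg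
        refine le_min ?_ ?_
        · calc _ ≤ a * (W l / a) := mul_le_mul (min_le_left _ _) hF1 hF0 hs.le
            _ = W l := mul_div_cancel₀ _ hs.ne'
        · calc _ ≤ b * (V l / b) := mul_le_mul (min_le_right _ _) hF2 hF0 hs'.le
            _ = V l := mul_div_cancel₀ _ hs'.ne'
      rw [← mul_assoc]
      refine (mul_le_mul_of_nonneg_right hmF hG0).trans ?_
      have hR : 0 ≤ D / 4 * treeCost N (fun k => L (k + 1)) (cellPart (L 0) l (w - v)) :=
        mul_nonneg (by positivity) (apply_nonneg _ _)
      rcases (hW0 l).eq_or_lt with h0 | hWl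
      · rw [← h0, min_eq_left (hV0 l), zero_mul]; exact hR
      rcases (hV0 l).eq_or_lt with h0 | hVl
      · rw [← h0, min_eq_right (hW0 l), zero_mul]; exact hR
      rw [map_sub]
      have hcell : ∀ {z : X → ℝ} {x}, 0 < cellPart (L 0) l z x → L 0 x = l := by
        intro z x hx
        by_contra hne
        simp [cellPart_apply, hne] at hx
      refine h₂.cost d (D / 4) (by positivity) hd hdd (fun k hk x y hxy => ?_) _ _
        (cellPart_nonneg (L 0) l hw) hWl (cellPart_nonneg (L 0) l hv) hVl (fun x y hx hy => ?_)
      · refine (hL (k + 1) (by omega) x y hxy).trans_eq ?_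
        rw [pow_succ' 4 (k + 1), div_div]
      · simpa using hL 0 (by omega) x y ((hcell hx).trans (hcell hy).symm)
    calc _ ≤ min a b * (D * ∫ ω₁, e ω₁ ∂μ₁ + ∑ l, (∫ ω₁, f l ω₁ ∂μ₁) * ∫ ω₂, g l ω₂ ∂μ₂) := by
          gcongr
      _ = D * (min a b * ∫ ω₁, e ω₁ ∂μ₁) +
          ∑ l, min a b * ((∫ ω₁, f l ω₁ ∂μ₁) * ∫ ω₂, g l ω₂ ∂μ₂) := by
          rw [mul_add, Finset.mul_sum]; ring
      _ ≤ D * levelCost (L 0) (w - v) +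
          ∑ l, D / 4 * treeCost N (fun k => L (k + 1)) (cellPart (L 0) l (w - v)) := by
          exact add_le_add (mul_le_mul_of_nonneg_left hE hD) (Finset.sum_le_sum fun l _ => hF l)
      _ = _ := by rw [treeCost_succ_apply, ← Finset.mul_sum]; ring

lemma exists_isTreeSampler [Nonempty X] (N : ℕ) (L : ℕ → X → X) :
    ∃ (Ω : Type) (_ : MeasurableSpace Ω) (_ : StandardBorelSpace Ω) (μ : Measure Ω)
      (_ : IsProbabilityMeasure μ) (Y : (X → ℝ) → Ω → X), IsTreeSampler N L μ Y := by
  induction N generalizing L with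
  | zero => exact ⟨_, inferInstance, inferInstance, _, inferInstance, _, isTreeSampler_zero L⟩
  | succ N ih =>
    obtain ⟨Ω, _, _, μ, _, Y, hY⟩ := ih fun k => L (k + 1)
    exact ⟨_, inferInstance, inferInstance, _, inferInstance, _, hY.succ⟩

end Tree

/-! ### The tree cost of a difference of point masses -/

section TreeCost

variable {X : Type} [Fintype X] [DecidableEq X]

omit [Fintype X] in
lemma cellPart_single (L : X → X) (l x : X) :
    cellPart L l (Pi.single x 1) = if L x = l then Pi.single x 1 else 0 := by
  ext y
  rw [cellPart_apply]
  by_cases hy : y = x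
  · subst hy; split_ifs <;> simp
  · split_ifs <;> simp [hy]

lemma sum_comp_cellPart_single (L : X → X) (x : X) (f : Seminorm ℝ (X → ℝ)) :
    ∑ l, f (cellPart L l (Pi.single x 1)) = f (Pi.single x 1) := by
  have : ∀ l, f (cellPart L l (Pi.single x 1)) = if L x = l then f (Pi.single x 1) else 0 := by
    intro l; rw [cellPart_single]; split_ifs <;> simp
  simp [this]

lemma levelCost_single (L : X → X) (x : X) : levelCost L (Pi.single x 1) = 2 := by
  have : ∀ l, |∑ y, cellPart L l (Pi.single x 1) y| = if L x = l then 1 else 0 := by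
    intro l; rw [cellPart_single]; split_ifs <;> simp
  rw [levelCost_apply]
  simp [this]
  norm_num

lemma treeCost_single_le (N : ℕ) (L : ℕ → X → X) (x : X) :
    treeCost N L (Pi.single x 1) ≤ 8 / 3 := by
  induction N generalizing L with
  | zero => rw [treeCost_zero_apply, levelCost_single]; norm_num
  | succ N ih =>
    rw [treeCost_succ_apply, levelCost_single, sum_comp_cellPart_single]
    linarith [ih fun k => L (k + 1)]

lemma levelCost_single_sub_single (L : X → X) (x y : X) :
    levelCost L (Pi.single x 1 - Pi.single y 1) ≤ if L x = L y then 0 else 2 := by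
  have h : ∀ l, |∑ z, cellPart L l (Pi.single x 1 - Pi.single y 1) z| =
      |(if L x = l then 1 else 0) - (if L y = l then 1 else 0 : ℝ)| := by
    intro l
    rw [map_sub, cellPart_single, cellPart_single]
    split_ifs <;> simp
  rw [levelCost_apply]
  simp only [h, Pi.sub_apply, Finset.sum_sub_distrib, Finset.sum_pi_single', Finset.mem_univ,
    if_true, sub_self, abs_zero, add_zero]
  split_ifs with hxy
  · simp [hxy]
  · refine (Finset.sum_le_sum fun l _ => abs_sub _ _).trans_eq ?_
    rw [Finset.sum_add_distrib]
    simp [apply_ite abs]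
    norm_num

/-- A difference of two point masses is cheap unless an early partition separates them. -/
lemma treeCost_single_sub_single_le (N : ℕ) (L : ℕ → X → X) (x y : X) :
    treeCost N L (Pi.single x 1 - Pi.single y 1) ≤
      (if x = y then 0 else 2 / 4 ^ N) +
        ∑ k ∈ Finset.range N, if L k x = L k y then 0 else (40 / 3) / 4 ^ (k + 1) := by
  induction N generalizing L with
  | zero =>
    rw [treeCost_zero_apply]
    refine (levelCost_single_sub_single id x y).trans_eq ?_
    simp
  | succ N ih =>
    have hnn : ∀ k, (0 : ℝ) ≤ if L k x = L k y then 0 else (40 / 3) / 4 ^ (k + 1) := by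
      intro k; split_ifs <;> positivity
    have hnn' : (0 : ℝ) ≤ if x = y then 0 else 2 / 4 ^ (N + 1) := by split_ifs <;> positivity
    have hl := levelCost_single_sub_single (L 0) x y
    rw [treeCost_succ_apply, Finset.sum_range_succ']
    by_cases h : L 0 x = L 0 y
    · have hsum : ∑ l, treeCost N (fun k => L (k + 1)) (cellPart (L 0) l
          (Pi.single x 1 - Pi.single y 1)) =
          treeCost N (fun k => L (k + 1)) (Pi.single x 1 - Pi.single y 1) := by
        rw [Finset.sum_eq_single (L 0 x)]
        · rw [map_sub, cellPart_single, cellPart_single, if_pos rfl, if_pos h.symm]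
        · intro l _ hne
          rw [map_sub, cellPart_single, cellPart_single, if_neg hne.symm,
            if_neg (h ▸ hne.symm), sub_zero, map_zero]
        · simp
      rw [if_pos h] at hl
      rw [hsum, if_pos h, add_zero]
      have h4 := mul_le_mul_of_nonneg_left (ih fun k => L (k + 1)) (by norm_num : (0 : ℝ) ≤ 4⁻¹)
      have e1 : (4⁻¹ : ℝ) * (if x = y then 0 else 2 / 4 ^ N) =
          if x = y then 0 else 2 / 4 ^ (N + 1) := by
        split_ifs
        · simp
        · rw [pow_succ]; field_simp
      have e2 : (4⁻¹ : ℝ) * ∑ k ∈ Finset.range N,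
          (if L (k + 1) x = L (k + 1) y then 0 else (40 / 3) / 4 ^ (k + 1)) =
          ∑ k ∈ Finset.range N,
            if L (k + 1) x = L (k + 1) y then 0 else (40 / 3) / (4 : ℝ) ^ (k + 1 + 1) := by
        rw [Finset.mul_sum]
        refine Finset.sum_congr rfl fun k _ => ?_
        split_ifs
        · simp
        · rw [pow_succ _ (k + 1)]; field_simp
      rw [mul_add, e1, e2] at h4
      linarith
    · have hsum : ∑ l, treeCost N (fun k => L (k + 1)) (cellPart (L 0) l
          (Pi.single x 1 - Pi.single y 1)) ≤ 16 / 3 := by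
        calc _ ≤ ∑ l, (treeCost N (fun k => L (k + 1)) (cellPart (L 0) l (Pi.single x 1)) +
              treeCost N (fun k => L (k + 1)) (cellPart (L 0) l (Pi.single y 1))) :=
              Finset.sum_le_sum fun l _ => by rw [map_sub]; exact map_sub_le_add _ _ _
          _ ≤ 8 / 3 + 8 / 3 := by
              rw [Finset.sum_add_distrib, sum_comp_cellPart_single, sum_comp_cellPart_single]
              exact add_le_add (treeCost_single_le N _ x) (treeCost_single_le N _ y)
          _ = 16 / 3 := by norm_num
      rw [if_neg h] at hl ⊢
      have := Finset.sum_nonneg fun k (_ : k ∈ Finset.range N) => hnn (k + 1)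
      have h10 : (40 / 3 : ℝ) / 4 ^ (0 + 1) = 10 / 3 := by norm_num
      rw [h10]
      linarith

/-- A seminorm of a difference of marginals is bounded by the average of its values on
differences of point masses. -/
lemma seminorm_sub_le_sum_coupling (f : Seminorm ℝ (X → ℝ)) {g : X × X → ℝ} (hg : ∀ z, 0 ≤ g z)
    {w v : X → ℝ} (hw : ∀ x, w x = ∑ y, g (x, y)) (hv : ∀ y, v y = ∑ x, g (x, y)) :
    f (w - v) ≤ ∑ z, g z * f (Pi.single z.1 1 - Pi.single z.2 1) := by
  have : w - v = ∑ z, g z • (Pi.single z.1 1 - Pi.single z.2 1 : X → ℝ) := by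
    ext t
    simp only [Pi.sub_apply, Finset.sum_apply, Pi.smul_apply, smul_eq_mul, mul_sub,
      Finset.sum_sub_distrib, hw, hv]
    congr 1
    · rw [Fintype.sum_prod_type]
      simp [Pi.single_apply, Finset.sum_ite_eq]
    · rw [Fintype.sum_prod_type_right]
      simp [Pi.single_apply, Finset.sum_ite_eq]
  rw [this]
  refine (Finset.le_sum_of_subadditive f (map_zero f).le (map_add_le_add f) _ _).trans_eq ?_
  refine Finset.sum_congr rfl fun z _ => ?_
  rw [map_smul_eq_mul, Real.norm_of_nonneg (hg z)]

end TreeCost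

/-! ### Realization on the standard probability space -/

lemma exists_measurable_map_stdSpace_eq {Ω : Type*} [MeasurableSpace Ω] [StandardBorelSpace Ω]
    (μ : Measure Ω) [IsProbabilityMeasure μ] :
    ∃ h : ℝ → Ω, Measurable h ∧ stdSpace.map h = μ := by
  have : Nonempty Ω := μ.nonempty_of_neZero
  obtain ⟨f, hf, hfμ⟩ := Measure.exists_measurable_map_eq μ
  have hproj : Measurable (Set.projIcc (0 : ℝ) 1 zero_le_one) := continuous_projIcc.measurable
  refine ⟨f ∘ Set.projIcc 0 1 zero_le_one, hf.comp hproj, ?_⟩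
  rw [← Measure.map_map hf hproj, ← hfμ]
  congr 1
  have h1 : stdSpace = (volume : Measure unitInterval).map Subtype.val :=
    (measurePreserving_subtype_coe measurableSet_Icc).map_eq.symm
  rw [h1, Measure.map_map hproj measurable_subtype_coe]
  have : Set.projIcc (0 : ℝ) 1 zero_le_one ∘ Subtype.val = id := by
    ext x; simp
  rw [this, Measure.map_id]

section Realization

variable {X : Type} [Fintype X] [DecidableEq X] [MeasurableSpace X] [DiscreteMeasurableSpace X]

omit [DecidableEq X] in
lemma integral_comp_pair_map {Ω Ω' : Type} [MeasurableSpace Ω] [MeasurableSpace Ω']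
    {μ : Measure Ω} {μ' : Measure Ω'} [IsProbabilityMeasure μ] {h : Ω' → Ω} (hh : Measurable h)
    (hμ : μ'.map h = μ) {A B : Ω → X} (hA : Measurable A) (hB : Measurable B) (d : X → X → ℝ) :
    ∫ ω, d (A (h ω)) (B (h ω)) ∂μ' = ∫ ω, d (A ω) (B ω) ∂μ := by
  subst hμ
  rw [integral_map hh.aemeasurable (integrable_comp_pair _ hA hB d).aestronglyMeasurable]

lemma IsTreeSampler.comp {N : ℕ} {L : ℕ → X → X} {Ω Ω' : Type} [MeasurableSpace Ω]
    [MeasurableSpace Ω'] {μ : Measure Ω} {μ' : Measure Ω'} [IsProbabilityMeasure μ]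
    {Y : (X → ℝ) → Ω → X} (hY : IsTreeSampler N L μ Y) {h : Ω' → Ω} (hh : Measurable h)
    (hμ : μ'.map h = μ) : IsTreeSampler N L μ' fun w => Y w ∘ h where
  measurable w := (hY.measurable w).comp hh
  pos w hw hs ω := hY.pos w hw hs (h ω)
  law w hw hs x := by
    have hm : MeasurableSet {ω | Y w ω = x} := hY.measurable w (measurableSet_singleton x)
    rw [← hY.law w hw hs x, ← hμ, map_measureReal_apply hh hm]
    rfl
  cost d D hD hd hdd hL w v hw hs hv hs' hsupp := by
    have := integral_comp_pair_map hh hμ (hY.measurable w) (hY.measurable v) d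
    simp only [Function.comp_apply]
    rw [this]
    exact hY.cost d D hD hd hdd hL w v hw hs hv hs' hsupp

lemma exists_isTreeSampler_stdSpace [Nonempty X] (N : ℕ) (L : ℕ → X → X) :
    ∃ Y : (X → ℝ) → ℝ → X, IsTreeSampler N L stdSpace Y := by
  obtain ⟨Ω, _, _, μ, _, Y, hY⟩ := exists_isTreeSampler N L
  obtain ⟨h, hh, hμ⟩ := exists_measurable_map_stdSpace_eq μ
  exact ⟨_, hY.comp hh hμ⟩

/-- Random partitions of a finite space into cells of geometrically decreasing diameter give a
simultaneous coupling of all probability measures. -/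
theorem exists_isCoupling_of_random_partitions [Nonempty X] {N : ℕ} {Ω : Type}
    [MeasurableSpace Ω] [StandardBorelSpace Ω] {ν : Measure Ω} [IsProbabilityMeasure ν]
    {G : Ω → Fin N → X → X} (hG : ∀ k x, Measurable fun ω => G ω k x)
    {d : X → X → ℝ} {D : ℝ} (hd : ∀ x y, 0 ≤ d x y) (hdd : ∀ x, d x x = 0)
    (hD : ∀ x y, d x y ≤ D)
    (hdiam : ∀ ω k x y, G ω k x = G ω k y → d x y ≤ D / 4 ^ (k.val + 1))
    {C : ℝ} (hsep : ∀ k x y, ν.real {ω | G ω k x ≠ G ω k y} * D ≤ C * d x y * 4 ^ (k.val + 1)) :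
    ∃ f : ProbabilityMeasure X → ℝ → X,
      IsCoupling (fun P : ProbabilityMeasure X => (P : Measure X)) f ∧
      ∀ (P Q : ProbabilityMeasure X) (γ : Measure (X × X)) [IsProbabilityMeasure γ],
        γ.map Prod.fst = P → γ.map Prod.snd = Q →
        ∫ u, d (f P u) (f Q u) ∂stdSpace ≤
          ∑ z, γ.real {z} *
            ((if z.1 = z.2 then 0 else 2 * D / 4 ^ N) + 40 / 3 * C * N * d z.1 z.2) := by
  have hD0 : 0 ≤ D := (hd (Classical.arbitrary X) (Classical.arbitrary X)).trans (hD _ _)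
  let ext (g : Fin N → X → X) (k : ℕ) : X → X := if h : k < N then g ⟨k, h⟩ else id
  have hext : ∀ g k (h : k < N), ext g k = g ⟨k, h⟩ := fun g k h => dif_pos h
  choose Y hY using fun g : Fin N → X → X => exists_isTreeSampler_stdSpace N (ext g)
  let wt (P : ProbabilityMeasure X) (x : X) : ℝ := (P : Measure X).real {x}
  have hwt : ∀ P x, 0 ≤ wt P x := fun P x => measureReal_nonneg
  have hwt1 : ∀ P, ∑ x, wt P x = 1 := fun P => by
    simp only [wt]
    rw [sum_measureReal_singleton]; simp
  let F (P : ProbabilityMeasure X) (ω : Ω × ℝ) : X := Y (G ω.1) (wt P) ω.2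
  have hGm : Measurable G := measurable_pi_lambda _ fun k => measurable_pi_lambda _ fun x => hG k x
  have hF : ∀ P, Measurable (F P) := fun P => by
    have : Measurable fun z : (Fin N → X → X) × ℝ => Y z.1 (wt P) z.2 :=
      measurable_from_prod_countable_right fun g => (hY g).measurable (wt P)
    exact this.comp ((hGm.comp measurable_fst).prodMk measurable_snd)
  obtain ⟨h, hh, hμ⟩ := exists_measurable_map_stdSpace_eq (ν.prod stdSpace)
  refine ⟨fun P => F P ∘ h, ⟨fun P => (hF P).comp hh, fun P => ?_⟩, fun P Q γ _ hγP hγQ => ?_⟩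
  · rw [← Measure.map_map (hF P) hh, hμ]
    have : IsProbabilityMeasure ((ν.prod stdSpace).map (F P)) :=
      Measure.isProbabilityMeasure_map (hF P).aemeasurable
    refine Measure.ext_of_singleton fun x => ?_
    rw [Measure.map_apply (hF P) (measurableSet_singleton x),
      Measure.prod_apply (hF P (measurableSet_singleton x))]
    have : ∀ ω, stdSpace (Prod.mk ω ⁻¹' (F P ⁻¹' {x})) = (P : Measure X) {x} := fun ω => by
      have := (hY (G ω)).law (wt P) (hwt P) (by rw [hwt1]; norm_num) x
      rw [hwt1, div_one] at this
      exact (measureReal_eq_measureReal_iff).1 this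
    simp [this]
  · have hmarg1 : ∀ x, wt P x = ∑ y, γ.real {(x, y)} := fun x => by
      simp only [wt]
      rw [← hγP, map_measureReal_apply measurable_fst (measurableSet_singleton x),
        ← Finset.sum_image (f := fun z => γ.real {z}) (g := fun y => (x, y))
          (by simp [Function.Injective]),
        sum_measureReal_singleton]
      congr 1; ext ⟨a, b⟩; simp [eq_comm]
    have hmarg2 : ∀ y, wt Q y = ∑ x, γ.real {(x, y)} := fun y => by
      simp only [wt]
      rw [← hγQ, map_measureReal_apply measurable_snd (measurableSet_singleton y),
        ← Finset.sum_image (f := fun z => γ.real {z}) (g := fun x => (x, y))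
          (by simp [Function.Injective]),
        sum_measureReal_singleton]
      congr 1; ext ⟨a, b⟩; simp [eq_comm]
    let s (ω : Ω) (k : Fin N) (z : X × X) : ℝ := if G ω k z.1 ≠ G ω k z.2 then 1 else 0
    have hms : ∀ k (z : X × X), MeasurableSet {ω | G ω k z.1 ≠ G ω k z.2} := fun k z =>
      (measurableSet_eq_fun (hG k z.1) (hG k z.2)).compl
    have hsi : ∀ k z, Integrable (fun ω => s ω k z) ν := fun k z =>
      integrable_comp_pair ν (hG k z.1) (hG k z.2) fun x y => if x ≠ y then 1 else 0
    let e (z : X × X) : ℝ := if z.1 = z.2 then 0 else 2 * D / 4 ^ N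
    have hBi : ∀ z, Integrable (fun ω =>
        γ.real {z} * (e z + ∑ k : Fin N, (40 / 3) * D / 4 ^ (k.val + 1) * s ω k z)) ν := fun z =>
      ((integrable_const _).add (integrable_finsetSum _ fun k _ =>
        (hsi k z).const_mul _)).const_mul _
    have hpt : ∀ ω, ∫ u, d (F P (ω, u)) (F Q (ω, u)) ∂stdSpace ≤
        ∑ z, γ.real {z} * (e z + ∑ k : Fin N, (40 / 3) * D / 4 ^ (k.val + 1) * s ω k z) := by
      intro ω
      have h1 := (hY (G ω)).cost d D hD0 hd hdd (fun k hk x y hxy => by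
        rw [hext _ k hk] at hxy; exact hdiam ω ⟨k, hk⟩ x y hxy) (wt P) (wt Q) (hwt P)
        (by rw [hwt1]; norm_num) (hwt Q) (by rw [hwt1]; norm_num) (fun x y _ _ => hD x y)
      rw [hwt1, hwt1, min_self, one_mul] at h1
      refine h1.trans ?_
      refine (mul_le_mul_of_nonneg_left (seminorm_sub_le_sum_coupling (treeCost N (ext (G ω)))
        (g := fun z => γ.real {z}) (fun z => measureReal_nonneg) hmarg1 hmarg2) hD0).trans ?_
      rw [Finset.mul_sum]
      refine Finset.sum_le_sum fun z _ => ?_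
      rw [mul_left_comm]
      refine mul_le_mul_of_nonneg_left ?_ measureReal_nonneg
      refine (mul_le_mul_of_nonneg_left
        (treeCost_single_sub_single_le N (ext (G ω)) z.1 z.2) hD0).trans_eq ?_
      rw [mul_add, Finset.sum_range, Finset.mul_sum]
      congr 1
      · simp only [e]; split_ifs <;> ring
      · refine Finset.sum_congr rfl fun k _ => ?_
        rw [hext _ k.val k.isLt]
        simp only [s, ne_eq, ite_not, Fin.eta]
        split_ifs <;> ring
    have hint : ∀ k z, ∫ ω, s ω k z ∂ν = ν.real {ω | G ω k z.1 ≠ G ω k z.2} := fun k z =>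
      integral_ite_one_zero (hms k z)
    calc ∫ u, d ((F P ∘ h) u) ((F Q ∘ h) u) ∂stdSpace
        = ∫ ω, d (F P ω) (F Q ω) ∂(ν.prod stdSpace) :=
          integral_comp_pair_map hh hμ (hF P) (hF Q) d
      _ = ∫ ω, ∫ u, d (F P (ω, u)) (F Q (ω, u)) ∂stdSpace ∂ν :=
          integral_prod _ (integrable_comp_pair _ (hF P) (hF Q) d)
      _ ≤ ∫ ω, ∑ z, γ.real {z} *
            (e z + ∑ k : Fin N, (40 / 3) * D / 4 ^ (k.val + 1) * s ω k z) ∂ν :=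
          integral_mono (integrable_comp_pair _ (hF P) (hF Q) d).integral_prod_left
            (integrable_finsetSum _ fun z _ => hBi z) hpt
      _ = ∑ z, γ.real {z} * (e z + ∑ k : Fin N, (40 / 3) * D / 4 ^ (k.val + 1) *
            ν.real {ω | G ω k z.1 ≠ G ω k z.2}) := by
          rw [integral_finsetSum _ fun z _ => hBi z]
          refine Finset.sum_congr rfl fun z _ => ?_
          rw [integral_const_mul, integral_add (integrable_const _)
            (integrable_finsetSum _ fun k _ => (hsi k z).const_mul _),
            integral_finsetSum _ fun k _ => (hsi k z).const_mul _]
          simp_rw [integral_const_mul, hint]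
          simp
      _ ≤ _ := by
          refine Finset.sum_le_sum fun z _ => mul_le_mul_of_nonneg_left ?_ measureReal_nonneg
          refine add_le_add le_rfl ?_
          refine (Finset.sum_le_sum (g := fun _ => 40 / 3 * C * d z.1 z.2)
            fun k _ => ?_).trans_eq ?_
          · have h4 : (0 : ℝ) < 4 ^ (k.val + 1) := by positivity
            rw [div_mul_eq_mul_div, div_le_iff₀ h4]
            linarith [hsep k z.1 z.2]
          · simp; ring

end Realization

/-! ### From linear costs to powers -/

section Power

variable {X : Type} [Fintype X] [DecidableEq X] [MeasurableSpace X] [DiscreteMeasurableSpace X]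

/-- A coupling with linear pairwise ratio at most `K` has pairwise ratio at most
`K * (dmax / dmin) ^ (q - 1)` for the `q`-th power of the cost. -/
theorem optRatio_rpow_le {d : X → X → ℝ} {dmin dmax q K : ℝ} (hq : 1 ≤ q) (hdmin : 0 < dmin)
    (hK : 1 ≤ K) (hle : dmin ≤ dmax) (hdd : ∀ x, d x x = 0) (hmin : ∀ x y, x ≠ y → dmin ≤ d x y)
    (hmax : ∀ x y, d x y ≤ dmax) {f : ProbabilityMeasure X → ℝ → X}
    (hf : IsCoupling (fun P : ProbabilityMeasure X => (P : Measure X)) f)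
    (hcost : ∀ (P Q : ProbabilityMeasure X) (γ : Measure (X × X)) [IsProbabilityMeasure γ],
      γ.map Prod.fst = P → γ.map Prod.snd = Q →
      ∫ u, d (f P u) (f Q u) ∂stdSpace ≤ ∑ z, γ.real {z} * (K * d z.1 z.2)) :
    optRatio (fun x y => d x y ^ q) (fun P : ProbabilityMeasure X => (P : Measure X)) ≤
      ENNReal.ofReal (K * (dmax / dmin) ^ (q - 1)) := by
  have hγ : 1 ≤ dmax / dmin := (one_le_div hdmin).2 hle
  have hr1 : 1 ≤ K * (dmax / dmin) ^ (q - 1) :=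
    one_le_mul_of_one_le_of_one_le hK (Real.one_le_rpow hγ (by linarith))
  have hd : ∀ x y, 0 ≤ d x y := fun x y => by
    by_cases h : x = y
    · rw [h, hdd]
    · exact hdmin.le.trans (hmin x y h)
  have hdmax : 0 < dmax := hdmin.trans_le hle
  have hup : ∀ x y, d x y ^ q ≤ dmax ^ (q - 1) * d x y := fun x y => by
    by_cases h : x = y
    · rw [h, hdd, Real.zero_rpow (by linarith), mul_zero]
    · have hpos := hdmin.trans_le (hmin x y h)
      calc d x y ^ q = d x y ^ (q - 1) * d x y := by
            rw [← Real.rpow_add_one hpos.ne']; ring_nf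
        _ ≤ _ := mul_le_mul_of_nonneg_right
            (Real.rpow_le_rpow (hd x y) (hmax x y) (by linarith)) (hd x y)
  have hlow : ∀ x y, dmin ^ (q - 1) * d x y ≤ d x y ^ q := fun x y => by
    by_cases h : x = y
    · rw [h, hdd, Real.zero_rpow (by linarith), mul_zero]
    · have hpos := hdmin.trans_le (hmin x y h)
      calc _ ≤ d x y ^ (q - 1) * d x y := mul_le_mul_of_nonneg_right
            (Real.rpow_le_rpow hdmin.le (hmin x y h) (by linarith)) (hd x y)
        _ = d x y ^ q := by rw [← Real.rpow_add_one hpos.ne']; ring_nf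
  refine (iInf₂_le f hf).trans (sInf_le ⟨?_, fun P Q => ?_⟩)
  · rw [← ENNReal.ofReal_one]; exact ENNReal.ofReal_le_ofReal hr1
  rw [Cstar, ENNReal.mul_iInf_of_ne (by simp; linarith) ENNReal.ofReal_ne_top]
  refine le_iInf fun γ => ?_
  rw [ENNReal.mul_iInf_of_ne (by simp; linarith) ENNReal.ofReal_ne_top]
  refine le_iInf fun ⟨hγp, hγP, hγQ⟩ => ?_
  have hi1 : Integrable (fun u => d (f P u) (f Q u)) stdSpace :=
    integrable_comp_pair stdSpace (hf.measurable P) (hf.measurable Q) d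
  have hiq : Integrable (fun u => d (f P u) (f Q u) ^ q) stdSpace :=
    integrable_comp_pair stdSpace (hf.measurable P) (hf.measurable Q) fun x y => d x y ^ q
  have hig : Integrable (fun z : X × X => d z.1 z.2 ^ q) γ := Integrable.of_finite
  have hig1 : Integrable (fun z : X × X => d z.1 z.2) γ := Integrable.of_finite
  rw [← ofReal_integral_eq_lintegral_ofReal hiq (.of_forall fun u => Real.rpow_nonneg (hd _ _) q),
    ← ofReal_integral_eq_lintegral_ofReal hig (.of_forall fun u => Real.rpow_nonneg (hd _ _) q),
    ← ENNReal.ofReal_mul (by linarith)]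
  refine ENNReal.ofReal_le_ofReal ?_
  have hsum : ∑ z, γ.real {z} * (K * d z.1 z.2) = K * ∫ z, d z.1 z.2 ∂γ := by
    rw [integral_fintype hig1, Finset.mul_sum]
    simp only [smul_eq_mul]
    exact Finset.sum_congr rfl fun z _ => by ring
  have hmq : 0 < dmin ^ (q - 1) := Real.rpow_pos_of_pos hdmin _
  calc ∫ u, d (f P u) (f Q u) ^ q ∂stdSpace
      ≤ ∫ u, dmax ^ (q - 1) * d (f P u) (f Q u) ∂stdSpace :=
        integral_mono hiq (hi1.const_mul _) fun u => hup _ _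
    _ ≤ dmax ^ (q - 1) * (K * ∫ z, d z.1 z.2 ∂γ) := by
        rw [integral_const_mul, ← hsum]
        exact mul_le_mul_of_nonneg_left (hcost P Q γ hγP hγQ) (Real.rpow_nonneg hdmax.le _)
    _ = K * (dmax / dmin) ^ (q - 1) * ∫ z, dmin ^ (q - 1) * d z.1 z.2 ∂γ := by
        rw [integral_const_mul, Real.div_rpow hdmax.le hdmin.le]
        field_simp
    _ ≤ _ := mul_le_mul_of_nonneg_left
        (integral_mono (hig1.const_mul _) hig fun z => hlow _ _) (by linarith)

end Power

/-! ### Volumes of differences of Euclidean balls -/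

section Ball

open Metric

lemma volume_ball_diff_ball_withLp_le {F : Type*} [NormedAddCommGroup F] [InnerProductSpace ℝ F]
    [FiniteDimensional ℝ F] [MeasurableSpace F] [BorelSpace F] (a : WithLp 2 (ℝ × F)) {δ : ℝ}
    (hδ : 0 ≤ δ) (R : ℝ) :
    volume (ball a R \ ball (a + WithLp.toLp 2 (δ, 0)) R) ≤
      ENNReal.ofReal δ * volume (ball a.snd R) := by
  have hmS : MeasurableSet (ball a R \ ball (a + WithLp.toLp 2 (δ, 0)) R) :=
    measurableSet_ball.diff measurableSet_ball
  rw [← (WithLp.volume_preserving_toLp ℝ F).measure_preimage hmS.nullMeasurableSet]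
  have hmS' := (WithLp.volume_preserving_toLp ℝ F).measurable hmS
  rw [Measure.volume_eq_prod, Measure.prod_apply_symm hmS',
    ← lintegral_indicator_const measurableSet_ball]
  refine lintegral_mono fun z => ?_
  set ρ := √(R ^ 2 - ‖z - a.snd‖ ^ 2)
  have key : ∀ t : ℝ, WithLp.toLp 2 (t, z) ∈ ball a R \ ball (a + WithLp.toLp 2 (δ, 0)) R →
      z ∈ ball a.snd R ∧ t ∈ Set.Icc (a.fst - ρ) (a.fst - ρ + δ) := by
    rintro t ⟨h1, h2⟩
    rw [mem_ball, WithLp.prod_dist_eq_of_L2, Real.dist_eq, sq_abs] at h1 h2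
    simp only [WithLp.add_fst, WithLp.add_snd, not_lt] at h1 h2
    have hR : 0 < R := (Real.sqrt_nonneg _).trans_lt h1
    rw [Real.sqrt_lt' hR, dist_eq_norm] at h1
    rw [Real.le_sqrt hR.le (by positivity), dist_eq_norm] at h2
    change (t - a.fst) ^ 2 + ‖z - a.snd‖ ^ 2 < R ^ 2 at h1
    change R ^ 2 ≤ (t - (a.fst + δ)) ^ 2 + ‖z - (a.snd + 0)‖ ^ 2 at h2
    rw [add_zero] at h2
    have hz : ‖z - a.snd‖ < R := by
      refine lt_of_pow_lt_pow_left₀ 2 hR.le ?_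
      nlinarith [sq_nonneg (t - a.fst)]
    have hρ : ρ ^ 2 = R ^ 2 - ‖z - a.snd‖ ^ 2 :=
      Real.sq_sqrt (by nlinarith [norm_nonneg (z - a.snd)])
    have hρ0 : 0 ≤ ρ := Real.sqrt_nonneg _
    have h3 : |t - a.fst| < ρ := abs_lt_of_sq_lt_sq (by linarith) hρ0
    have h4 : ρ ≤ |t - (a.fst + δ)| := by
      refine le_of_sq_le_sq ?_ (abs_nonneg _)
      rw [sq_abs]; linarith
    rw [abs_lt] at h3
    refine ⟨by rwa [mem_ball, dist_eq_norm], by linarith, ?_⟩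
    rcases le_abs'.1 h4 with h | h <;> linarith
  by_cases hz : z ∈ ball a.snd R
  · rw [Set.indicator_of_mem hz]
    calc _ ≤ volume (Set.Icc (a.fst - ρ) (a.fst - ρ + δ)) :=
          measure_mono fun t ht => (key t ht).2
      _ = ENNReal.ofReal δ := by rw [Real.volume_Icc]; congr 1; ring
  · rw [Set.indicator_of_notMem hz, nonpos_iff_eq_zero, ← measure_empty (μ := (volume : Measure ℝ))]
    congr 1
    exact Set.eq_empty_of_forall_notMem fun t ht => hz (key t ht).1

/-- The part of a ball not covered by a translate lies in a thin slab over a lower-dimensional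
ball. -/
lemma volume_ball_diff_ball_le {m : ℕ} (a b : EuclideanSpace ℝ (Fin (m + 1))) (R : ℝ) :
    volume (ball a R \ ball b R) ≤
      ENNReal.ofReal ‖b - a‖ * volume (ball (0 : EuclideanSpace ℝ (Fin m)) R) := by
  have hrank : Module.finrank ℝ (WithLp 2 (ℝ × EuclideanSpace ℝ (Fin m))) = m + 1 := by
    rw [(WithLp.linearEquiv 2 ℝ (ℝ × EuclideanSpace ℝ (Fin m))).finrank_eq]
    simp [add_comm]
  obtain ⟨Φ, hΦ⟩ : ∃ Φ : EuclideanSpace ℝ (Fin (m + 1)) ≃ₗᵢ[ℝ]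
      WithLp 2 (ℝ × EuclideanSpace ℝ (Fin m)), Φ (b - a) = WithLp.toLp 2 (‖b - a‖, 0) := by
    let Ψ := ((stdOrthonormalBasis ℝ
      (WithLp 2 (ℝ × EuclideanSpace ℝ (Fin m)))).reindex (finCongr hrank)).repr.symm
    have hnorm : ‖Ψ (b - a)‖ =
        ‖(WithLp.toLp 2 (‖b - a‖, 0) : WithLp 2 (ℝ × EuclideanSpace ℝ (Fin m)))‖ := by
      rw [LinearIsometryEquiv.norm_map, WithLp.prod_norm_eq_of_L2]
      simp
    exact ⟨Ψ.trans (Submodule.reflection _), Submodule.reflection_sub hnorm⟩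
  have hpre : ball a R \ ball b R =
      Φ ⁻¹' (ball (Φ a) R \ ball (Φ a + WithLp.toLp 2 (‖b - a‖, 0)) R) := by
    rw [← hΦ, ← map_add, add_sub_cancel, Set.preimage_sdiff]
    congr 1 <;> (ext; simp)
  rw [hpre, Φ.measurePreserving.measure_preimage
    (measurableSet_ball.diff measurableSet_ball).nullMeasurableSet]
  refine (volume_ball_diff_ball_withLp_le _ (norm_nonneg _) R).trans_eq ?_
  rw [Measure.addHaar_ball_center]

lemma volume_ball_euclidean_fin {m : ℕ} (x : EuclideanSpace ℝ (Fin m)) {r : ℝ} (hr : 0 < r) :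
    volume (ball x r) = ENNReal.ofReal (r ^ m * (√Real.pi ^ m / Real.Gamma (m / 2 + 1))) := by
  rcases m with _ | m
  · rw [volume_euclideanSpace_eq_dirac]
    simp [Subsingleton.elim x 0, hr]
  · rw [EuclideanSpace.volume_ball, Fintype.card_fin, ENNReal.ofReal_mul (by positivity),
      ENNReal.ofReal_pow hr.le]

lemma gamma_add_half_le {s : ℝ} (hs : 0 < s) :
    Real.Gamma (s + 1 / 2) ≤ √s * Real.Gamma s := by
  have h := Real.Gamma_mul_add_mul_le_rpow_Gamma_mul_rpow_Gamma hs (by linarith : 0 < s + 1)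
    (by norm_num : (0 : ℝ) < 1 / 2) (by norm_num : (0 : ℝ) < 1 / 2) (by norm_num)
  rw [Real.Gamma_add_one hs.ne', ← Real.sqrt_eq_rpow, ← Real.sqrt_eq_rpow,
    Real.sqrt_mul hs.le] at h
  have hG := Real.mul_self_sqrt (Real.Gamma_pos_of_pos hs).le
  calc _ = Real.Gamma (1 / 2 * s + 1 / 2 * (s + 1)) := by ring_nf
    _ ≤ _ := h
    _ = √s * (√(Real.Gamma s) * √(Real.Gamma s)) := by ring
    _ = _ := by rw [hG]

lemma volume_ball_le_mul_volume_ball_succ {m : ℕ} {R : ℝ} (hR : 0 < R) :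
    volume (ball (0 : EuclideanSpace ℝ (Fin m)) R) ≤
      ENNReal.ofReal (√(m + 1) / (√Real.pi * R)) *
        volume (ball (0 : EuclideanSpace ℝ (Fin (m + 1))) R) := by
  rw [volume_ball_euclidean_fin _ hR, volume_ball_euclidean_fin _ hR,
    ← ENNReal.ofReal_mul (by positivity)]
  refine ENNReal.ofReal_le_ofReal ?_
  have hs : (0 : ℝ) < m / 2 + 1 := by positivity
  have h1 := gamma_add_half_le hs
  have h2 : √((m : ℝ) / 2 + 1) ≤ √(m + 1) :=
    Real.sqrt_le_sqrt (by have : (0 : ℝ) ≤ m := Nat.cast_nonneg m; linarith)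
  have hG := Real.Gamma_pos_of_pos hs
  have e : ((m + 1 : ℕ) : ℝ) / 2 + 1 = m / 2 + 1 + 1 / 2 := by push_cast; ring
  have hG' : 0 < Real.Gamma (m / 2 + 1 + 1 / 2) := Real.Gamma_pos_of_pos (by positivity)
  have hpi : 0 < √Real.pi := Real.sqrt_pos.2 Real.pi_pos
  rw [e]
  have h3 : Real.Gamma (m / 2 + 1 + 1 / 2) ≤ √(m + 1) * Real.Gamma (m / 2 + 1) :=
    h1.trans (mul_le_mul_of_nonneg_right h2 hG.le)
  have h4 : 1 / Real.Gamma (m / 2 + 1) ≤ √(m + 1) / Real.Gamma (m / 2 + 1 + 1 / 2) := by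
    rw [div_le_div_iff₀ hG hG']; linarith
  calc R ^ m * (√Real.pi ^ m / Real.Gamma (m / 2 + 1))
      = R ^ m * √Real.pi ^ m * (1 / Real.Gamma (m / 2 + 1)) := by ring
    _ ≤ R ^ m * √Real.pi ^ m * (√(m + 1) / Real.Gamma (m / 2 + 1 + 1 / 2)) := by gcongr
    _ = _ := by field_simp; ring

lemma volume_symmDiff_ball_le {m : ℕ} (a b : EuclideanSpace ℝ (Fin (m + 1))) {R : ℝ}
    (hR : 0 < R) :
    volume (symmDiff (ball a R) (ball b R)) ≤
      ENNReal.ofReal (2 * √(m + 1) / √Real.pi * (‖a - b‖ / R)) * volume (ball a R) := by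
  have h : ∀ a b : EuclideanSpace ℝ (Fin (m + 1)), volume (ball a R \ ball b R) ≤
      ENNReal.ofReal (√(m + 1) / √Real.pi * (‖a - b‖ / R)) *
        volume (ball (0 : EuclideanSpace ℝ (Fin (m + 1))) R) := fun a b => by
    refine (volume_ball_diff_ball_le a b R).trans
      ((mul_le_mul_right (volume_ball_le_mul_volume_ball_succ hR) _).trans_eq ?_)
    rw [← mul_assoc, ← ENNReal.ofReal_mul (norm_nonneg _), norm_sub_rev]
    congr 2
    field_simp
  rw [Measure.addHaar_ball_center, Set.symmDiff_def]
  refine (measure_union_le _ _).trans ((add_le_add (h a b) (h b a)).trans_eq ?_)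
  rw [norm_sub_rev b a, ← add_mul, ← ENNReal.ofReal_add (by positivity) (by positivity)]
  congr 2
  ring

end Ball

/-! ### Random ball carving -/

lemma measure_div_le_of_le_mul {c a b t : ℝ≥0∞} (hc0 : c ≠ 0)
    (hc : c ≠ ⊤) (h : a ≤ t * b) : c * a / (c * b) ≤ t := by
  rw [ENNReal.mul_div_mul_left _ _ hc0 hc]
  exact ENNReal.div_le_of_le_mul h

section Carving

variable {X : Type} [Fintype X] [MeasurableSpace X]

open Metric in
/-- Carving balls of radii `R k` around a common i.i.d. sequence of centers produces random
partitions with small cells which rarely separate close points. -/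
theorem exists_random_partitions [Nonempty X] {m N : ℕ} (φ : X → EuclideanSpace ℝ (Fin (m + 1)))
    {R : Fin N → ℝ} (hR : ∀ k, 0 < R k) :
    ∃ (Ω : Type) (_ : MeasurableSpace Ω) (_ : StandardBorelSpace Ω) (ν : Measure Ω)
      (_ : IsProbabilityMeasure ν) (G : Ω → Fin N → X → X),
      (∀ k x, Measurable fun ω => G ω k x) ∧
      (∀ ω k x y, G ω k x = G ω k y → x = y ∨ ‖φ x - φ y‖ < 2 * R k) ∧
      ∀ k x y, ν.real {ω | G ω k x ≠ G ω k y} ≤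
        2 * √(m + 1) / √Real.pi * (‖φ x - φ y‖ / R k) := by
  classical
  let M : ℝ := ∑ x, ‖φ x‖ + ∑ k, R k + 1
  have hsub : ∀ k x, ball (φ x) (R k) ⊆ ball 0 M := fun k x => by
    refine ball_subset_ball' ?_
    have h1 := Finset.single_le_sum (f := fun x => ‖φ x‖) (fun x _ => norm_nonneg _)
      (Finset.mem_univ x)
    have h2 := Finset.single_le_sum (f := R) (fun k _ => (hR k).le) (Finset.mem_univ k)
    rw [dist_zero_right]
    simp only [M]
    linarith
  have hM : 0 < M := by
    have h1 := Finset.sum_nonneg fun x (_ : x ∈ Finset.univ) => norm_nonneg (φ x)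
    have h2 := Finset.sum_nonneg fun k (_ : k ∈ Finset.univ) => (hR k).le
    simp only [M]; linarith
  let V : Measure (EuclideanSpace ℝ (Fin (m + 1))) := volume
  have hVM0 : V (ball 0 M) ≠ 0 := (measure_ball_pos _ _ hM).ne'
  have hVM : V (ball 0 M) ≠ ⊤ := measure_ball_lt_top.ne
  let μ : Measure (EuclideanSpace ℝ (Fin (m + 1))) := ProbabilityTheory.cond V (ball 0 M)
  have : IsProbabilityMeasure μ := ProbabilityTheory.cond_isProbabilityMeasure_of_finite hVM0 hVM
  have hμ : ∀ A ⊆ ball 0 M, μ A = (V (ball 0 M))⁻¹ * V A := fun A hA => by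
    rw [ProbabilityTheory.cond_apply measurableSet_ball, Set.inter_eq_right.2 hA]
  have hc0 : (V (ball 0 M))⁻¹ ≠ 0 := ENNReal.inv_ne_zero.2 hVM
  have hc : (V (ball 0 M))⁻¹ ≠ ⊤ := ENNReal.inv_ne_top.2 hVM0
  have hV0 : ∀ k x, V (ball (φ x) (R k)) ≠ 0 := fun k x => (measure_ball_pos _ _ (hR k)).ne'
  let ν : Measure (ℕ → EuclideanSpace ℝ (Fin (m + 1))) := Measure.infinitePi fun _ => μ
  let l (k : Fin N) (ω : ℕ → EuclideanSpace ℝ (Fin (m + 1))) (x : X) : ℕ :=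
    firstHit (ball (φ x) (R k)) ω
  let good : Set (ℕ → EuclideanSpace ℝ (Fin (m + 1))) := {ω | ∀ k x, ∃ j, ω j ∈ ball (φ x) (R k)}
  have hgoodm : MeasurableSet good := by
    simp only [good, Set.ofPred_forall, Set.ofPred_exists]
    exact MeasurableSet.iInter fun k => MeasurableSet.iInter fun x => MeasurableSet.iUnion fun j =>
      measurable_pi_apply j measurableSet_ball
  have hgood : ν goodᶜ = 0 := by
    have : goodᶜ = ⋃ k, ⋃ x, {ω | ∀ j, ω j ∉ ball (φ x) (R k)} := by
      ext ω; simp [good]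
    rw [this]
    refine measure_iUnion_null fun k => measure_iUnion_null fun x =>
      infinitePi_never_mem μ measurableSet_ball ?_
    rw [hμ _ (hsub k x)]
    exact mul_ne_zero hc0 (hV0 k x)
  let rep (L : X → ℕ) (x : X) : X := Function.invFun L (L x)
  have hrep : ∀ (L : X → ℕ) x, L (rep L x) = L x := fun L x => Function.invFun_eq ⟨x, rfl⟩
  let G (ω : ℕ → EuclideanSpace ℝ (Fin (m + 1))) (k : Fin N) (x : X) : X :=
    if ω ∈ good then rep (l k ω) x else x
  refine ⟨_, inferInstance, inferInstance, ν, inferInstance, G, fun k x => ?_,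
    fun ω k x y h => ?_, fun k x y => ?_⟩
  · refine Measurable.ite hgoodm ?_ measurable_const
    have hl : Measurable fun ω => l k ω :=
      measurable_pi_lambda _ fun x => measurable_firstHit measurableSet_ball
    exact (Measurable.of_discrete (f := fun L : X → ℕ => rep L x)).comp hl
  · by_cases hω : ω ∈ good
    · right
      simp only [G, hω, if_true] at h
      have hxy : l k ω x = l k ω y :=
        (hrep (l k ω) x).symm.trans ((congrArg (l k ω) h).trans (hrep (l k ω) y))
      have hx := mem_ball.1 (firstHit_mem (hω k x))
      have hy := mem_ball.1 (firstHit_mem (hω k y))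
      change dist (ω (l k ω x)) _ < _ at hx
      change dist (ω (l k ω y)) _ < _ at hy
      rw [hxy] at hx
      rw [← dist_eq_norm]
      linarith [dist_triangle_left (φ x) (φ y) (ω (l k ω y))]
    · left
      simpa only [G, hω, if_false] using h
  · refine ENNReal.toReal_le_of_le_ofReal (by have := hR k; positivity) ?_
    have hss : {ω | G ω k x ≠ G ω k y} ⊆
        {ω | firstHit (ball (φ x) (R k)) ω ≠ firstHit (ball (φ y) (R k)) ω} ∪ goodᶜ := by
      intro ω h
      by_cases hω : ω ∈ good
      · left
        intro heq
        refine h ?_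
        simp only [G, hω, if_true, rep]
        congr 1
      · exact Or.inr hω
    refine (measure_mono hss).trans ((measure_union_le _ _).trans ?_)
    rw [hgood, add_zero]
    refine (infinitePi_firstHit_ne_le μ measurableSet_ball measurableSet_ball).trans ?_
    rw [hμ _ (hsub k x), hμ _ (Set.symmDiff_subset_union.trans
      (Set.union_subset (hsub k x) (hsub k y)))]
    exact measure_div_le_of_le_mul hc0 hc (volume_symmDiff_ball_le (φ x) (φ y) (hR k))

end Carving

/-! ### Comparison of `ℓ_p` norms -/

section LpNorm

lemma rpow_sum_le_rpow_sum {ι : Type*} [Fintype ι] {a b : ℝ} (ha : 0 < a) (hab : a ≤ b)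
    (z : ι → ℝ) : (∑ i, |z i| ^ b) ^ (1 / b) ≤ (∑ i, |z i| ^ a) ^ (1 / a) := by
  have hb : 0 < b := ha.trans_le hab
  have hs : 0 ≤ ∑ i, |z i| ^ a := Finset.sum_nonneg fun i _ => by positivity
  set T := (∑ i, |z i| ^ a) ^ (1 / a) with hT
  have hT0 : 0 ≤ T := Real.rpow_nonneg hs _
  have hTa : T ^ a = ∑ i, |z i| ^ a := by
    rw [hT, ← Real.rpow_mul hs, one_div_mul_cancel ha.ne', Real.rpow_one]
  have hle : ∀ i, |z i| ≤ T := fun i => by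
    rw [← Real.rpow_le_rpow_iff (abs_nonneg _) hT0 ha, hTa]
    exact Finset.single_le_sum (f := fun i => |z i| ^ a) (fun i _ => by positivity)
      (Finset.mem_univ i)
  have hsum : ∑ i, |z i| ^ b ≤ T ^ b := by
    calc ∑ i, |z i| ^ b = ∑ i, |z i| ^ a * |z i| ^ (b - a) := by
          refine Finset.sum_congr rfl fun i _ => ?_
          rw [← Real.rpow_add_of_nonneg (abs_nonneg _) ha.le (by linarith)]
          ring_nf
      _ ≤ ∑ i, |z i| ^ a * T ^ (b - a) := by
          refine Finset.sum_le_sum fun i _ => mul_le_mul_of_nonneg_left ?_ (by positivity)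
          exact Real.rpow_le_rpow (abs_nonneg _) (hle i) (by linarith)
      _ = T ^ b := by
          rw [← Finset.sum_mul, ← hTa, ← Real.rpow_add_of_nonneg hT0 ha.le (by linarith)]
          ring_nf
  calc _ ≤ (T ^ b) ^ (1 / b) :=
        Real.rpow_le_rpow (Finset.sum_nonneg fun i _ => by positivity) hsum (by positivity)
    _ = T := by rw [← Real.rpow_mul hT0, mul_one_div_cancel hb.ne', Real.rpow_one]

lemma rpow_sum_le_card_mul_rpow_sum {ι : Type*} [Fintype ι] {a b : ℝ} (ha : 0 < a)
    (hab : a ≤ b) (z : ι → ℝ) :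
    (∑ i, |z i| ^ a) ^ (1 / a) ≤
      (Fintype.card ι : ℝ) ^ (1 / a - 1 / b) * (∑ i, |z i| ^ b) ^ (1 / b) := by
  have hb : 0 < b := ha.trans_le hab
  have hs : 0 ≤ ∑ i, |z i| ^ a := Finset.sum_nonneg fun i _ => by positivity
  have h := Real.rpow_sum_le_const_mul_sum_rpow (s := Finset.univ) (fun i => |z i| ^ a)
    ((one_le_div ha).2 hab)
  have habs : ∀ i, |(|z i| ^ a)| = |z i| ^ a := fun i => abs_of_nonneg (by positivity)
  simp only [habs] at h
  have e : ∀ i, (|z i| ^ a) ^ (b / a) = |z i| ^ b := fun i => by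
    rw [← Real.rpow_mul (abs_nonneg _)]; field_simp
  simp only [e, Finset.card_univ] at h
  have h2 := Real.rpow_le_rpow (Real.rpow_nonneg hs _) h (by positivity : 0 ≤ 1 / b)
  rw [← Real.rpow_mul hs, Real.mul_rpow (by positivity)
    (Finset.sum_nonneg fun i _ => by positivity), ← Real.rpow_mul (by positivity)] at h2
  convert h2 using 2
  · field_simp
  · congr 1; field_simp

lemma lpNorm_nonneg (p : ℝ≥0∞) {n : ℕ} (z : Fin n → ℝ) : 0 ≤ _root_.lpNorm p z := by
  rw [_root_.lpNorm]
  split_ifs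
  · exact Real.iSup_nonneg fun i => abs_nonneg _
  · exact Real.rpow_nonneg (Finset.sum_nonneg fun i _ => by positivity) _

lemma norm_toLp_two_eq {n : ℕ} (z : Fin n → ℝ) :
    ‖(WithLp.toLp 2 z : EuclideanSpace ℝ (Fin n))‖ = (∑ i, |z i| ^ (2 : ℝ)) ^ (1 / (2 : ℝ)) := by
  rw [EuclideanSpace.norm_eq, Real.sqrt_eq_rpow]
  simp

/-- Two-sided comparison of the `ℓ_p` and Euclidean norms with the sharp product of constants. -/
lemma exists_lpNorm_comparison {n : ℕ} (hn : 1 ≤ n) {p : ℝ≥0∞} (hp : 1 ≤ p) :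
    ∃ A B : ℝ, 0 < A ∧ 0 < B ∧
      √n * (A * B) = (n : ℝ) ^ max (p⁻¹).toReal (1 - (p⁻¹).toReal) ∧
      ∀ z : Fin n → ℝ, _root_.lpNorm p z ≤ A * ‖(WithLp.toLp 2 z : EuclideanSpace ℝ (Fin n))‖ ∧
        ‖(WithLp.toLp 2 z : EuclideanSpace ℝ (Fin n))‖ ≤ B * _root_.lpNorm p z := by
  have hn0 : (0 : ℝ) < n := by exact_mod_cast hn
  have : Nonempty (Fin n) := ⟨⟨0, hn⟩⟩
  by_cases hpt : p = ⊤
  · subst hpt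
    refine ⟨1, √n, one_pos, Real.sqrt_pos.2 hn0, by simp, fun z => ⟨?_, ?_⟩⟩
    · rw [_root_.lpNorm, if_pos rfl, one_mul]
      exact ciSup_le fun i => by
        simpa using PiLp.norm_apply_le (WithLp.toLp 2 z : EuclideanSpace ℝ (Fin n)) i
    · rw [_root_.lpNorm, if_pos rfl, EuclideanSpace.norm_eq]
      have hM : ∀ i, |z i| ≤ ⨆ i, |z i| := le_ciSup (Set.finite_range fun i => |z i|).bddAbove
      refine Real.sqrt_le_iff.2
        ⟨mul_nonneg (Real.sqrt_nonneg _) (Real.iSup_nonneg fun i => abs_nonneg _), ?_⟩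
      rw [mul_pow, Real.sq_sqrt hn0.le]
      calc ∑ i, ‖(WithLp.toLp 2 z : EuclideanSpace ℝ (Fin n)) i‖ ^ 2
          ≤ ∑ _i : Fin n, (⨆ i, |z i|) ^ 2 := Finset.sum_le_sum fun i _ =>
            pow_le_pow_left₀ (norm_nonneg _) (by simpa using hM i) 2
        _ = _ := by simp
  set P := p.toReal
  have hP : 1 ≤ P := by
    rw [← ENNReal.toReal_one]; exact ENNReal.toReal_mono hpt hp
  have hP0 : 0 < P := by linarith
  have hinv : (p⁻¹).toReal = 1 / P := by rw [ENNReal.toReal_inv, one_div]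
  have hlp : ∀ z : Fin n → ℝ, _root_.lpNorm p z = (∑ i, |z i| ^ P) ^ (1 / P) := fun z => by
    rw [_root_.lpNorm, if_neg hpt]
  rw [hinv, Real.sqrt_eq_rpow]
  simp only [hlp, norm_toLp_two_eq]
  rcases le_total P 2 with h2 | h2
  · have h : 1 / 2 ≤ 1 / P := one_div_le_one_div_of_le hP0 h2
    refine ⟨(n : ℝ) ^ (1 / P - 1 / 2), 1, by positivity, one_pos, ?_, fun z => ⟨?_, ?_⟩⟩
    · rw [mul_one, ← Real.rpow_add hn0, max_eq_left (by linarith)]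
      ring_nf
    · simpa using rpow_sum_le_card_mul_rpow_sum hP0 h2 z
    · rw [one_mul]; exact rpow_sum_le_rpow_sum hP0 h2 z
  · have h : 1 / P ≤ 1 / 2 := one_div_le_one_div_of_le two_pos h2
    refine ⟨1, (n : ℝ) ^ (1 / 2 - 1 / P), one_pos, by positivity, ?_, fun z => ⟨?_, ?_⟩⟩
    · rw [one_mul, ← Real.rpow_add hn0, max_eq_right (by linarith)]
      ring_nf
    · rw [one_mul]; exact rpow_sum_le_rpow_sum two_pos h2 z
    · simpa using rpow_sum_le_card_mul_rpow_sum two_pos h2 z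

end LpNorm

/-- The coupling ratio of a finite subset of `ℝⁿ`, in terms of the number `N` of scales used. -/
lemma finite_lp_optRatio_le {n : ℕ} (hn : 1 ≤ n) {p : ℝ≥0∞} (hp : 1 ≤ p)
    {q : ℝ} (hq : 1 ≤ q) {S : Finset (Fin n → ℝ)} (hS : S.Nonempty) {dmax dmin : ℝ}
    (hpos : 0 < dmin) (hle : dmin ≤ dmax)
    (hmax : ∀ x ∈ S, ∀ y ∈ S, _root_.lpNorm p (x - y) ≤ dmax)
    (hmin : ∀ x ∈ S, ∀ y ∈ S, x ≠ y → dmin ≤ _root_.lpNorm p (x - y)) (N : ℕ)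
    {K M : ℝ} (hM : M = (n : ℝ) ^ max (p⁻¹).toReal (1 - (p⁻¹).toReal))
    (hK : K = 160 / (3 * √Real.pi) * M * N + 2 * (dmax / dmin) / 4 ^ N) (hK1 : 1 ≤ K) :
    optRatio (fun x y : {z : Fin n → ℝ // z ∈ S} => _root_.lpNorm p (x.1 - y.1) ^ q)
        (fun P : ProbabilityMeasure {z : Fin n → ℝ // z ∈ S} =>
          (P : Measure {z : Fin n → ℝ // z ∈ S}))
      ≤ ENNReal.ofReal (K * (dmax / dmin) ^ (q - 1)) := by
  classical
  obtain ⟨m, rfl⟩ : ∃ m, n = m + 1 := ⟨n - 1, by omega⟩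
  obtain ⟨A, B, hA, hB, hAB, hcmp⟩ := exists_lpNorm_comparison hn hp
  have : Nonempty {z : Fin (m + 1) → ℝ // z ∈ S} := hS.to_subtype
  have hD : 0 < dmax := hpos.trans_le hle
  let X := {z : Fin (m + 1) → ℝ // z ∈ S}
  let d : X → X → ℝ := fun x y => _root_.lpNorm p (x.1 - y.1)
  have hd : ∀ x y, 0 ≤ d x y := fun x y => lpNorm_nonneg p _
  have hdd : ∀ x, d x x = 0 := fun x => by
    refine le_antisymm ?_ (hd x x)
    simpa [d] using (hcmp 0).1
  let φ : X → EuclideanSpace ℝ (Fin (m + 1)) := fun x => WithLp.toLp 2 x.1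
  have hφ : ∀ x y, φ x - φ y = WithLp.toLp 2 (x.1 - y.1) := fun x y => rfl
  let R : Fin N → ℝ := fun k => dmax / 4 ^ (k.val + 1) / (2 * A)
  have hR : ∀ k, 0 < R k := fun k => by positivity
  obtain ⟨Ω, _, _, ν, _, G, hGm, hG, hGs⟩ := exists_random_partitions φ hR
  have hπ : 0 < √Real.pi := Real.sqrt_pos.2 Real.pi_pos
  have hdiam : ∀ ω k x y, G ω k x = G ω k y → d x y ≤ dmax / 4 ^ (k.val + 1) := by
    intro ω k x y h
    rcases hG ω k x y h with rfl | h
    · rw [hdd]; positivity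
    · have h1 : d x y ≤ A * ‖φ x - φ y‖ := (hcmp (x.1 - y.1)).1
      refine h1.trans ((mul_le_mul_of_nonneg_left h.le hA.le).trans_eq ?_)
      simp only [R]; field_simp
  have hsep : ∀ k x y, ν.real {ω | G ω k x ≠ G ω k y} * dmax ≤
      (4 / √Real.pi * M) * d x y * 4 ^ (k.val + 1) := by
    intro k x y
    have h1 : ‖φ x - φ y‖ ≤ B * d x y := (hcmp (x.1 - y.1)).2
    calc _ ≤ 2 * √(m + 1) / √Real.pi * (‖φ x - φ y‖ / R k) * dmax :=
          mul_le_mul_of_nonneg_right (hGs k x y) hD.le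
      _ ≤ 2 * √(m + 1) / √Real.pi * (B * d x y / R k) * dmax := by
          have := hR k
          gcongr
      _ = _ := by
          rw [hM, ← hAB]
          push_cast
          simp only [R]; field_simp
          ring
  obtain ⟨f, hf, hcost⟩ := exists_isCoupling_of_random_partitions hGm hd hdd
    (fun x y => hmax x.1 x.2 y.1 y.2) hdiam hsep
  refine optRatio_rpow_le (d := d) hq hpos hK1 hle hdd
    (fun x y h => hmin x.1 x.2 y.1 y.2 (fun e => h (Subtype.ext e)))
    (fun x y => hmax x.1 x.2 y.1 y.2) hf fun P Q γ _ h1 h2 => (hcost P Q γ h1 h2).trans ?_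
  refine Finset.sum_le_sum fun z _ => mul_le_mul_of_nonneg_left ?_ measureReal_nonneg
  have hite : (if z.1 = z.2 then 0 else 2 * dmax / 4 ^ N) ≤
      2 * (dmax / dmin) / 4 ^ N * d z.1 z.2 := by
    split_ifs with h
    · have := hd z.1 z.2
      positivity
    · have h3 : dmin ≤ d z.1 z.2 := hmin _ z.1.2 _ z.2.2 fun e => h (Subtype.ext e)
      calc 2 * dmax / 4 ^ N = 2 * (dmax / dmin) / 4 ^ N * dmin := by field_simp
        _ ≤ _ := by gcongr
  refine (add_le_add_left hite _).trans_eq ?_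
  rw [hK]
  field_simp
  ring

/-- Choice of the number of scales as a function of the aspect ratio. -/
lemma exists_scales_bound {y : ℝ} (hy : 0 < y) :
    ∃ N : ℕ, 160 / (3 * √Real.pi) * N + 2 * y / 4 ^ N < 28.66 * Real.log (y + 1) := by
  have hlog2 := Real.log_two_gt_d9
  rcases lt_or_ge y 1 with h | h
  · refine ⟨0, ?_⟩
    have h1 := Real.one_sub_inv_le_log_of_pos (by linarith : 0 < y + 1)
    have h2 : y / 2 ≤ 1 - (y + 1)⁻¹ := by
      rw [show 1 - (y + 1)⁻¹ = y / (y + 1) by field_simp; ring]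
      exact div_le_div_of_nonneg_left hy.le (by linarith) (by linarith)
    norm_num
    linarith
  · obtain ⟨N, h1, h2⟩ := exists_nat_pow_near h (by norm_num : (1 : ℝ) < 4)
    refine ⟨N, ?_⟩
    have hπ : 1.7724 < √Real.pi := by
      rw [Real.lt_sqrt (by norm_num)]
      linarith [Real.pi_gt_d4]
    have hc : 160 / (3 * √Real.pi) ≤ 30.1 := by
      rw [div_le_iff₀ (by linarith)]
      linarith
    have h3 : 2 * y / 4 ^ N < 8 := by
      rw [div_lt_iff₀ (by positivity)]
      rw [pow_succ] at h2
      linarith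
    have h4 : 160 / (3 * √Real.pi) * N ≤ 30.1 * N :=
      mul_le_mul_of_nonneg_right hc (Nat.cast_nonneg N)
    rcases Nat.eq_zero_or_pos N with rfl | hN
    · have : Real.log 2 ≤ Real.log (y + 1) := Real.log_le_log (by norm_num) (by linarith)
      simp only [Nat.cast_zero, mul_zero] at h4
      norm_num at *
      linarith
    · have h5 : Real.log (4 ^ N) ≤ Real.log (y + 1) :=
        Real.log_le_log (by positivity) (by linarith)
      rw [Real.log_pow, show (4 : ℝ) = 2 ^ 2 by norm_num, Real.log_pow] at h5
      have hN1 : (1 : ℝ) ≤ N := by exact_mod_cast hN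
      have h6 : 0.6931471803 * (N : ℝ) ≤ Real.log 2 * N := by gcongr
      push_cast at h5
      linarith

/-- finite subsets of `ℝⁿ` with `ℓ_p` power costs, `q ≥ 1`. Let
`S ⊆ ℝⁿ` be finite with `|S| ≥ 2`, `p ∈ [1,∞]`, `q ≥ 1`, `c(x,y) = ‖x − y‖_p^q`,
`m = n^{max{1/p, 1−1/p}}`, and `γ = (max pairwise ℓ_p distance)/(min nonzero pairwise
ℓ_p distance)`. Then `r*_c(P(S)) < 28.66 m γ^{q−1} log(γ/m + 1)`. -/
theorem finite_lp_optRatio_lt (n : ℕ) (hn : 1 ≤ n) (p : ℝ≥0∞) (hp : 1 ≤ p)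
    (q : ℝ) (hq : 1 ≤ q) (S : Finset (Fin n → ℝ)) (hS : 2 ≤ S.card)
    (dmax dmin : ℝ)
    (hdmax : IsGreatest {d : ℝ | ∃ x ∈ S, ∃ y ∈ S, d = lpNorm p (x - y)} dmax)
    (hdmin : IsLeast {d : ℝ | ∃ x ∈ S, ∃ y ∈ S, x ≠ y ∧ d = lpNorm p (x - y)} dmin) :
    optRatio (fun x y : {z : Fin n → ℝ // z ∈ S} => lpNorm p (x.1 - y.1) ^ q)
        (fun P : ProbabilityMeasure {z : Fin n → ℝ // z ∈ S} =>
          (P : Measure {z : Fin n → ℝ // z ∈ S}))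
      < ENNReal.ofReal
          (28.66 * (n : ℝ) ^ max (p⁻¹).toReal (1 - (p⁻¹).toReal) *
            (dmax / dmin) ^ (q - 1) *
            Real.log
              (dmax / dmin / ((n : ℝ) ^ max (p⁻¹).toReal (1 - (p⁻¹).toReal)) + 1)) := by
  obtain ⟨x₀, hx₀, y₀, hy₀, d₀, hd₀⟩ := hdmin.1
  obtain ⟨A, B, hA, hB, hAB, hcmp⟩ := exists_lpNorm_comparison hn hp
  have hpos : 0 < dmin := by
    have h1 : 0 < ‖(WithLp.toLp 2 (x₀ - y₀) : EuclideanSpace ℝ (Fin n))‖ := by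
      rw [norm_pos_iff]
      simpa [sub_eq_zero] using d₀
    rw [hd₀]
    exact pos_of_mul_pos_right (h1.trans_le (hcmp _).2) hB.le
  have hmax : ∀ x ∈ S, ∀ y ∈ S, _root_.lpNorm p (x - y) ≤ dmax := fun x hx y hy =>
    hdmax.2 ⟨x, hx, y, hy, rfl⟩
  have hmin : ∀ x ∈ S, ∀ y ∈ S, x ≠ y → dmin ≤ _root_.lpNorm p (x - y) :=
    fun x hx y hy h => hdmin.2 ⟨x, hx, y, hy, h, rfl⟩
  have hle : dmin ≤ dmax := hd₀ ▸ hmax x₀ hx₀ y₀ hy₀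
  set M := (n : ℝ) ^ max (p⁻¹).toReal (1 - (p⁻¹).toReal) with hM
  set g := dmax / dmin
  have hM1 : 1 ≤ M := Real.one_le_rpow (by exact_mod_cast hn)
    (le_max_of_le_left ENNReal.toReal_nonneg)
  have hg : 1 ≤ g := (one_le_div hpos).2 hle
  obtain ⟨N, hlt⟩ := exists_scales_bound (show 0 < g / M by positivity)
  have hK : 160 / (3 * √Real.pi) * M * N + 2 * g / 4 ^ N =
      M * (160 / (3 * √Real.pi) * N + 2 * (g / M) / 4 ^ N) := by
    field_simp
  have hK1 : 1 ≤ 160 / (3 * √Real.pi) * M * N + 2 * g / 4 ^ N := by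
    rcases Nat.eq_zero_or_pos N with rfl | hN
    · norm_num; linarith
    · have hπ : √Real.pi ≤ 2 := Real.sqrt_le_iff.2 ⟨by norm_num, by linarith [Real.pi_lt_four]⟩
      have h1 : 1 ≤ 160 / (3 * √Real.pi) := by
        rw [one_le_div (by positivity)]; linarith
      have h2 : (1 : ℝ) ≤ N := by exact_mod_cast hN
      have h3 : 1 ≤ 160 / (3 * √Real.pi) * M * N :=
        one_le_mul_of_one_le_of_one_le (one_le_mul_of_one_le_of_one_le h1 hM1) h2
      have h4 : 0 ≤ 2 * g / 4 ^ N := by positivity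
      linarith
  refine (finite_lp_optRatio_le hn hp hq ⟨x₀, hx₀⟩ hpos hle hmax hmin N hM rfl hK1).trans_lt ?_
  have hgq : 0 < g ^ (q - 1) := by positivity
  have hlt2 := mul_lt_mul_of_pos_right (mul_lt_mul_of_pos_left hlt (one_pos.trans_le hM1)) hgq
  rw [← hK] at hlt2
  have hlt3 : (160 / (3 * √Real.pi) * M * N + 2 * g / 4 ^ N) * g ^ (q - 1) <
      28.66 * M * g ^ (q - 1) * Real.log (g / M + 1) := by
    linarith
  exact (ENNReal.ofReal_lt_ofReal_iff_of_nonneg (by positivity)).2 hlt3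

end
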